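/- arXiv:1707.06129 — 2 statements merged into one kernel-verified Lean document; each statement's English description precedes it below -/
import Mathlib

section
/- Assume Hypotheses 1–3. There exists c > 0 such that for every a > 0, every non-negative function ψ : 𝕏 → ℝ, every y ∈ ℝ, z ≥ 0 and n ≥ 1, sup_{x∈𝕏} 𝔼_x( ψ(X_n) ; y+S_n ∈ [z,z+a] , τ_y > n ) ≤ c·‖ψ‖_∞·n^{−3/2}·(1+a³)·(1+z)·(1+max(y,0)). -/
open Finset Filter Real Topology MeasureTheory

namespace CLLT

variable {X : Type*}

/-- Product of the transition weights along a path. -/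
noncomputable def wt (P : X → X → ℝ) : X → List X → ℝ
  | _, [] => 1
  | x, y :: ys => P x y * wt P y ys

/-- Extension of a finite path `X₁, …, Xₙ` to a trajectory `ℕ → X` with `X₀ = x`
(values beyond time `n` are irrelevant and set to `x`). -/
def pathExt (x : X) {n : ℕ} (path : Fin n → X) : ℕ → X := fun k =>
  if h : 1 ≤ k ∧ k ≤ n then path ⟨k - 1, by omega⟩ else x

/-- Expectation `𝔼_x (F (X₀, X₁, …))` of a functional of the first `n` steps of the
Markov chain with transition kernel `P` started at `X₀ = x`. -/
noncomputable def Ex [Fintype X] (P : X → X → ℝ) (x : X) (n : ℕ)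
    (F : (ℕ → X) → ℝ) : ℝ :=
  ∑ path : Fin n → X, wt P x (List.ofFn path) * F (pathExt x path)

open Classical in
/-- Real-valued indicator of a proposition. -/
noncomputable def ind (p : Prop) : ℝ := if p then 1 else 0

/-- Partial sum `S_k = f(X₁) + ⋯ + f(X_k)` along a trajectory. -/
noncomputable def Spath (f : X → ℝ) (ω : ℕ → X) (k : ℕ) : ℝ :=
  ∑ i ∈ Finset.Icc 1 k, f (ω i)

/-- The event `τ_y > n`, i.e. `y + S_k > 0` for all `k = 1, …, n`. -/
def survives (f : X → ℝ) (y : ℝ) (n : ℕ) (ω : ℕ → X) : Prop :=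
  ∀ k ∈ Finset.Icc 1 n, 0 < y + Spath f ω k

/-- `n`-step transition kernel. -/
noncomputable def kpow [Fintype X] [DecidableEq X] (P : X → X → ℝ) : ℕ → X → X → ℝ
  | 0 => fun x x' => if x = x' then 1 else 0
  | n + 1 => fun x x' => ∑ y, P x y * kpow P n y x'

/-- Transition operator acting on functions. -/
noncomputable def Pop [Fintype X] (P : X → X → ℝ) (g : X → ℝ) (x : X) : ℝ :=
  ∑ x', P x x' * g x'

/-- Asymptotic variance `σ² = ν(f²) + 2 ∑_{n ≥ 1} ν(f ⬝ Pⁿ f)`. -/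
noncomputable def sigma2 [Fintype X] (P : X → X → ℝ) (ν f : X → ℝ) : ℝ :=
  (∑ x, f x ^ 2 * ν x) + 2 * ∑' n : ℕ, ∑ x, f x * ((Pop P)^[n + 1] f) x * ν x

/-- Hypothesis 1 (primitivity). -/
def Primitive [Fintype X] [DecidableEq X] (P : X → X → ℝ) : Prop :=
  ∃ k₀ : ℕ, 1 ≤ k₀ ∧ ∀ x x', 0 < kpow P k₀ x x'

/-- Hypothesis 3 (non-lattice condition). -/
def NonLattice [Fintype X] (P : X → X → ℝ) (f : X → ℝ) : Prop :=
  ∀ θ a : ℝ, ∃ (n : ℕ) (g : Fin (n + 1) → X),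
    (0 < ∏ i : Fin (n + 1), P (g i) (g (i + 1))) ∧
    ∀ m : ℤ, (∑ i, f (g i)) - (n + 1 : ℝ) * θ ≠ a * (m : ℝ)

/-- `P` is a stochastic matrix and `ν` is a positive invariant probability for it. -/
structure IsStochastic [Fintype X] (P : X → X → ℝ) (ν : X → ℝ) : Prop where
  nonneg : ∀ x x', 0 ≤ P x x'
  rowSum : ∀ x, ∑ x', P x x' = 1
  nuPos : ∀ x, 0 < ν x
  nuSum : ∑ x, ν x = 1
  nuInv : ∀ x', ∑ x, ν x * P x x' = ν x'

/-- Dual kernel `P*(x, x') = ν(x') P(x', x) / ν(x)`. -/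
noncomputable def dualK (P : X → X → ℝ) (ν : X → ℝ) (x x' : X) : ℝ :=
  ν x' * P x' x / ν x

/-- Sup norm of a function on a finite set. -/
noncomputable def supN [Fintype X] [Nonempty X] (ψ : X → ℝ) : ℝ := ⨆ x, |ψ x|

/-- Rayleigh density `φ₊(t) = t e^{-t²/2} 𝟙_{t ≥ 0}`. -/
noncomputable def rayleigh (t : ℝ) : ℝ := if 0 ≤ t then t * Real.exp (-t ^ 2 / 2) else 0

/-- Centred normal density with standard deviation `s`. -/
noncomputable def gauss (s u : ℝ) : ℝ :=
  Real.exp (-u ^ 2 / (2 * s ^ 2)) / (s * Real.sqrt (2 * π))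

/-- Perturbed transition operator `P_t`, as a complex matrix. -/
noncomputable def Pmat [Fintype X] (P : X → X → ℝ) (f : X → ℝ) (t : ℝ) : Matrix X X ℂ :=
  Matrix.of fun x x' => (P x x' : ℂ) * Complex.exp (Complex.I * (t : ℂ) * (f x' : ℂ))

/-- A complex matrix viewed as a continuous linear operator on `X → ℂ`
(equipped with the sup norm). -/
noncomputable def toCLM [Fintype X] (M : Matrix X X ℂ) : (X → ℂ) →L[ℂ] (X → ℂ) :=
  LinearMap.toContinuousLinearMap M.mulVecLin

/-- Fourier transform `ĥ(t) = ∫ e^{-i t u} h(u) du`. -/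
noncomputable def FT (h : ℝ → ℝ) (t : ℝ) : ℂ :=
  ∫ u : ℝ, Complex.exp (-(Complex.I * (t : ℂ) * (u : ℂ))) * (h u : ℂ)

/-- Convolution `(g ∗ k)(u) = ∫ g(v) k(u - v) dv`. -/
noncomputable def convR (g k : ℝ → ℝ) (u : ℝ) : ℝ := ∫ v : ℝ, g v * k (u - v)

/-- Stone's kernel `κ`. -/
noncomputable def kapp (u : ℝ) : ℝ :=
  if u = 0 then 1 / (2 * π) else (Real.sin (u / 2) / (u / 2)) ^ 2 / (2 * π)

/-- Scaled kernel `κ_δ(u) = κ(u/δ)/δ`. -/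
noncomputable def kappD (δ u : ℝ) : ℝ := kapp (u / δ) / δ

/-- Upper regularisation `h̄_ε(u) = sup_{v ∈ [u-ε, u+ε]} h(v)`. -/
noncomputable def upReg (h : ℝ → ℝ) (ε u : ℝ) : ℝ := sSup (h '' Set.Icc (u - ε) (u + ε))

/-- Lower regularisation `ẖ_ε(u) = inf_{v ∈ [u-ε, u+ε]} h(v)`. -/
noncomputable def loReg (h : ℝ → ℝ) (ε u : ℝ) : ℝ := sInf (h '' Set.Icc (u - ε) (u + ε))

/-- The class `𝓗_ε`: non-negative, locally bounded, with `h`, `h̄_ε`, `ẖ_ε`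
measurable and Lebesgue integrable. -/
def MemH (ε : ℝ) (h : ℝ → ℝ) : Prop :=
  (∀ u, 0 ≤ h u) ∧ (∀ K : Set ℝ, IsCompact K → BddAbove (h '' K)) ∧
  Measurable h ∧ Measurable (upReg h ε) ∧ Measurable (loReg h ε) ∧
  Integrable h ∧ Integrable (upReg h ε) ∧ Integrable (loReg h ε)

/-! ## Edge walks -/

/-- Positive-weight paths of a given length with a given total sum. -/
inductive Reach (Q : X → X → ℝ) (g : X → X → ℝ) : ℕ → X → X → ℝ → Prop
  | nil (x : X) : Reach Q g 0 x x 0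
  | cons {n : ℕ} {x x' x'' : X} {s : ℝ} (h : 0 < Q x x') (hr : Reach Q g n x' x'' s) :
      Reach Q g (n + 1) x x'' (g x x' + s)

theorem Reach.cast {Q g : X → X → ℝ} {n m : ℕ} {x y : X} {s t : ℝ}
    (h : Reach Q g n x y s) (hn : n = m) (hs : s = t) : Reach Q g m x y t := by
  subst hn; subst hs; exact h

theorem Reach.trans' {Q g : X → X → ℝ} {n m : ℕ} {x y z : X} {s t : ℝ}
    (h : Reach Q g n x y s) (h' : Reach Q g m y z t) : Reach Q g (n + m) x z (s + t) := by
  induction h with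
  | nil x => simpa using h'
  | cons hq _ ih =>
    have := Reach.cons hq (ih h')
    exact this.cast (by ring) (by ring)

theorem Reach.single {Q g : X → X → ℝ} {x y : X} (h : 0 < Q x y) :
    Reach Q g 1 x y (g x y) :=
  (Reach.cons h (Reach.nil y)).cast rfl (by simp)

theorem Reach.iter {Q g : X → X → ℝ} {n : ℕ} {x : X} {s : ℝ}
    (h : Reach Q g n x x s) (k : ℕ) : Reach Q g (k * n) x x (k * s) := by
  induction k with
  | zero => exact (Reach.nil x).cast (by simp) (by simp)
  | succ k ih => exact (ih.trans' h).cast (by ring) (by push_cast; ring)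

theorem Reach.reverse {Q g Q' g' : X → X → ℝ} (hQ : ∀ x y, 0 < Q x y → 0 < Q' y x)
    (hg : ∀ x y, g' y x = - g x y) {n : ℕ} {x y : X} {s : ℝ}
    (h : Reach Q g n x y s) : Reach Q' g' n y x (-s) := by
  induction h with
  | nil x => exact (Reach.nil x).cast rfl (by simp)
  | @cons n x x' x'' s hq _ ih =>
    exact (ih.trans' (Reach.single (hQ _ _ hq))).cast rfl (by rw [hg]; ring)

/-- Standing assumptions on an edge walk; invariant under time reversal. -/
structure Good [Fintype X] (Q g : X → X → ℝ) (ν : X → ℝ) : Prop where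
  nonneg : ∀ x x', 0 ≤ Q x x'
  rowSum : ∀ x, ∑ x', Q x x' = 1
  nuPos : ∀ x, 0 < ν x
  nuInv : ∀ x', ∑ x, ν x * Q x x' = ν x'
  mean : ∑ x, ∑ x', ν x * Q x x' * g x x' = 0
  nl : ∃ m : ℕ, ∀ x x', ∃ s₁ s₂, s₁ ≠ s₂ ∧ Reach Q g m x x' s₁ ∧ Reach Q g m x x' s₂

theorem Good.dual [Fintype X] {Q g : X → X → ℝ} {ν : X → ℝ} (h : Good Q g ν) :
    Good (dualK Q ν) (fun x x' => - g x' x) ν where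
  nonneg x x' := div_nonneg (mul_nonneg (h.nuPos _).le (h.nonneg _ _)) (h.nuPos _).le
  rowSum x := by
    simp only [dualK]
    rw [← Finset.sum_div, h.nuInv, div_self (h.nuPos x).ne']
  nuPos := h.nuPos
  nuInv x' := by
    have : ∀ x, ν x * dualK Q ν x x' = ν x' * Q x' x := fun x => by
      have := (h.nuPos x).ne'
      simp only [dualK]; field_simp
    simp only [this]
    rw [← Finset.mul_sum, h.rowSum, mul_one]
  mean := by
    have : ∀ x x', ν x * dualK Q ν x x' * - g x' x = - (ν x' * Q x' x * g x' x) := fun x x' => by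
      have := (h.nuPos x).ne'
      simp only [dualK]; field_simp
    simp only [this, Finset.sum_neg_distrib]
    rw [Finset.sum_comm, h.mean, neg_zero]
  nl := by
    obtain ⟨m, hm⟩ := h.nl
    refine ⟨m, fun x x' => ?_⟩
    obtain ⟨s₁, s₂, hne, r₁, r₂⟩ := hm x' x
    have hQ : ∀ x y, 0 < Q x y → 0 < dualK Q ν y x := fun x y hq =>
      div_pos (mul_pos (h.nuPos _) hq) (h.nuPos _)
    exact ⟨-s₁, -s₂, fun e => hne (neg_injective e), r₁.reverse hQ (fun _ _ => rfl),
      r₂.reverse hQ (fun _ _ => rfl)⟩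

/-! ## From the hypotheses to `Good` -/

theorem reach_of_kpow [Fintype X] [DecidableEq X] {P : X → X → ℝ} (hP : ∀ x x', 0 ≤ P x x')
    (g : X → X → ℝ) (n : ℕ) : ∀ x x', 0 < kpow P n x x' → ∃ s, Reach P g n x x' s := by
  induction n with
  | zero =>
    intro x x' h
    by_cases e : x = x'
    · subst e; exact ⟨0, Reach.nil x⟩
    · simp [kpow, e] at h
  | succ n ih =>
    intro x x' h
    simp only [kpow] at h
    obtain ⟨y, -, hy⟩ := Finset.exists_lt_of_sum_lt (s := Finset.univ) (f := fun _ : X => (0:ℝ))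
      (g := fun y => P x y * kpow P n y x') (by simpa using h)
    have h1 : 0 < P x y := by
      rcases (hP x y).lt_or_eq with h | h
      · exact h
      · simp [← h] at hy
    have h2 : 0 < kpow P n y x' := pos_of_mul_pos_right hy h1.le
    obtain ⟨s, hs⟩ := ih y x' h2
    exact ⟨_, Reach.cons h1 hs⟩

theorem reach_cycle {P : X → X → ℝ} (f : X → ℝ) (n : ℕ) (c : Fin (n + 1) → X)
    (h : ∀ i, 0 < P (c i) (c (i + 1))) :
    Reach P (fun _ x' => f x') (n + 1) (c 0) (c 0) (∑ i, f (c i)) := by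
  have hs : ∀ k : ℕ, Fin.ofNat (n + 1) (k + 1) = Fin.ofNat (n + 1) k + 1 := by
    intro k
    ext
    simp [Fin.ofNat, Fin.val_add]
  have key : ∀ k : ℕ, Reach P (fun _ x' => f x') k (c 0) (c (Fin.ofNat (n + 1) k))
      (∑ i ∈ Finset.range k, f (c (Fin.ofNat (n + 1) i + 1))) := by
    intro k
    induction k with
    | zero => exact (Reach.nil _).cast rfl (by simp)
    | succ k ih =>
      have := ih.trans' (Reach.single (g := fun _ x' => f x') (h (Fin.ofNat (n + 1) k)))
      rw [Finset.sum_range_succ, hs]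
      exact this
  have := key (n + 1)
  have e0 : Fin.ofNat (n + 1) (n + 1) = 0 := by ext; simp [Fin.ofNat]
  rw [e0] at this
  refine this.cast rfl ?_
  rw [Finset.sum_range (fun i => f (c (Fin.ofNat (n + 1) i + 1)))]
  have e1 : ∀ i : Fin (n + 1), Fin.ofNat (n + 1) (i : ℕ) = i := by
    intro i; ext; simp [Fin.ofNat, Nat.mod_eq_of_lt i.2]
  simp only [e1]
  exact Equiv.sum_comp (Equiv.addRight (1 : Fin (n + 1))) (fun i => f (c i))

theorem good_of_hyp [Fintype X] [DecidableEq X] [Nonempty X]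
    (P : X → X → ℝ) (ν f : X → ℝ) (hS : IsStochastic P ν)
    (h1 : Primitive P) (h2 : ∑ x, f x * ν x = 0) (h3 : NonLattice P f) :
    Good P (fun _ x' => f x') ν where
  nonneg := hS.nonneg
  rowSum := hS.rowSum
  nuPos := hS.nuPos
  nuInv := hS.nuInv
  mean := by
    rw [Finset.sum_comm]
    simp only [← Finset.sum_mul, hS.nuInv]
    rw [← h2]
    exact Finset.sum_congr rfl fun x _ => mul_comm _ _
  nl := by
    obtain ⟨k, hk1, hk⟩ := h1
    have conn : ∀ x x', ∃ s, Reach P (fun _ x' => f x') k x x' s := fun x x' =>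
      reach_of_kpow hS.nonneg _ k x x' (hk x x')
    have ex : ∃ m x x' s₁ s₂, s₁ ≠ s₂ ∧ Reach P (fun _ x' => f x') m x x' s₁ ∧
        Reach P (fun _ x' => f x') m x x' s₂ := by
      by_contra hcon
      push Not at hcon
      have uniq : ∀ m x x' s₁ s₂, Reach P (fun _ x' => f x') m x x' s₁ →
          Reach P (fun _ x' => f x') m x x' s₂ → s₁ = s₂ := by
        intro m x x' s₁ s₂ r₁ r₂
        by_contra hne
        exact hcon m x x' s₁ s₂ hne r₁ r₂
      obtain ⟨x⟩ := (inferInstance : Nonempty X)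
      obtain ⟨s0, hs0⟩ := conn x x
      obtain ⟨n, c, hc, hm⟩ := h3 (s0 / k) 0
      have hpos : ∀ i, 0 < P (c i) (c (i + 1)) := by
        intro i
        rcases (hS.nonneg (c i) (c (i + 1))).lt_or_eq with h | h
        · exact h
        · rw [Finset.prod_eq_zero (Finset.mem_univ i) h.symm] at hc
          exact absurd hc (lt_irrefl _)
      have cyc := reach_cycle f n c hpos
      obtain ⟨α, hα⟩ := conn x (c 0)
      obtain ⟨β, hβ⟩ := conn (c 0) x
      have r1 := (hα.trans' (cyc.iter k)).trans' hβ
      have r2 := (hα.trans' hβ).trans' (hs0.iter (n + 1))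
      have e := uniq _ _ _ _ _ r1 (r2.cast (by ring) rfl)
      apply hm 0
      have hk0 : (k : ℝ) ≠ 0 := by positivity
      push_cast at e
      have : (k : ℝ) * ∑ i, f (c i) = (n + 1) * s0 := by linarith
      field_simp
      push_cast
      linarith
    obtain ⟨m, a, b, s₁, s₂, hne, r₁, r₂⟩ := ex
    refine ⟨k + m + k, fun x x' => ?_⟩
    obtain ⟨α, hα⟩ := conn x a
    obtain ⟨β, hβ⟩ := conn b x'
    exact ⟨_, _, by simpa using hne, (hα.trans' r₁).trans' hβ, (hα.trans' r₂).trans' hβ⟩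

/-! ## Characteristic functions -/

/-- Fourier-perturbed kernel of an edge walk. -/
noncomputable def Phi (Q g : X → X → ℝ) (t : ℝ) : Matrix X X ℂ :=
  Matrix.of fun x x' => (Q x x' : ℂ) * Complex.exp (((t * g x x' : ℝ) : ℂ) * Complex.I)

theorem norm_Phi {Q g : X → X → ℝ} (hQ : ∀ x x', 0 ≤ Q x x') (t : ℝ) (x x' : X) :
    ‖Phi Q g t x x'‖ = Q x x' := by
  simp only [Phi, Matrix.of_apply, norm_mul, Complex.norm_exp_ofReal_mul_I, mul_one,
    Complex.norm_real, Real.norm_eq_abs, abs_of_nonneg (hQ x x')]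

theorem norm_Phi_pow [Fintype X] [DecidableEq X] {Q g : X → X → ℝ} (hQ : ∀ x x', 0 ≤ Q x x')
    (t : ℝ) (n : ℕ) : ∀ x x', ‖(Phi Q g t ^ n) x x'‖ ≤ ((Matrix.of Q) ^ n) x x' := by
  induction n with
  | zero =>
    intro x x'
    by_cases e : x = x'
    · subst e; simp
    · simp [Matrix.one_apply_ne e]
  | succ n ih =>
    intro x x'
    rw [pow_succ', pow_succ', Matrix.mul_apply, Matrix.mul_apply]
    refine (norm_sum_le _ _).trans (Finset.sum_le_sum fun j _ => ?_)
    rw [norm_mul, norm_Phi hQ]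
    exact mul_le_mul_of_nonneg_left (ih j x') (hQ x j)

theorem Phi_pow_reach [Fintype X] [DecidableEq X] {Q g : X → X → ℝ} (hQ : ∀ x x', 0 ≤ Q x x')
    {n : ℕ} {x x' : X} {s : ℝ} (h : Reach Q g n x x' s) :
    ∃ c > 0, ∀ t : ℝ, ‖(Phi Q g t ^ n) x x' -
      (c : ℝ) * Complex.exp (((t * s : ℝ) : ℂ) * Complex.I)‖ ≤ ((Matrix.of Q) ^ n) x x' - c := by
  induction h with
  | nil x => exact ⟨1, one_pos, fun t => by simp⟩
  | @cons n x y x' s hq hr ih =>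
    obtain ⟨c, hc, ih⟩ := ih
    refine ⟨Q x y * c, mul_pos hq hc, fun t => ?_⟩
    have e1 : (((Q x y * c : ℝ)) : ℂ) * Complex.exp (((t * (g x y + s) : ℝ) : ℂ) * Complex.I)
        = ∑ j, if j = y then Phi Q g t x y *
          ((c : ℝ) * Complex.exp (((t * s : ℝ) : ℂ) * Complex.I)) else 0 := by
      rw [Finset.sum_ite_eq' Finset.univ y]
      simp only [Finset.mem_univ, if_true, Phi, Matrix.of_apply]
      push_cast
      rw [mul_add, add_mul, Complex.exp_add]
      ring
    have e2 : Q x y * c = ∑ j, if j = y then Q x y * c else 0 := by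
      rw [Finset.sum_ite_eq' Finset.univ y]; simp
    rw [e1, pow_succ', pow_succ', Matrix.mul_apply, Matrix.mul_apply, ← Finset.sum_sub_distrib]
    conv_rhs => rw [e2]
    rw [← Finset.sum_sub_distrib]
    refine (norm_sum_le _ _).trans (Finset.sum_le_sum fun j _ => ?_)
    by_cases hj : j = y
    · subst hj
      simp only [if_true]
      rw [← mul_sub, norm_mul, norm_Phi hQ, Matrix.of_apply, ← mul_sub]
      exact mul_le_mul_of_nonneg_left (ih t) (hQ x j)
    · simp only [hj, if_false, sub_zero]
      rw [norm_mul, norm_Phi hQ]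
      exact mul_le_mul_of_nonneg_left (norm_Phi_pow hQ t n j x') (hQ x j)

theorem disc_lemma_sq {w : ℂ} {c q α : ℝ}
    (h : ‖w - (c : ℝ) * Complex.exp ((α : ℂ) * Complex.I)‖ ≤ q - c) :
    2 * c * (q - (w.re * cos α + w.im * sin α)) ≤ q ^ 2 - ‖w‖ ^ 2 := by
  have h2 : ‖w - (c : ℝ) * Complex.exp ((α : ℂ) * Complex.I)‖ ^ 2 ≤ (q - c) ^ 2 :=
    pow_le_pow_left₀ (norm_nonneg _) h 2
  rw [Complex.sq_norm, Complex.normSq_apply] at h2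
  rw [Complex.sq_norm, Complex.normSq_apply]
  simp only [Complex.sub_re, Complex.sub_im, Complex.re_ofReal_mul, Complex.im_ofReal_mul,
    Complex.exp_ofReal_mul_I_re, Complex.exp_ofReal_mul_I_im] at h2
  have h3 := sin_sq_add_cos_sq α
  have h4 : c ^ 2 * (sin α ^ 2 + cos α ^ 2) = c ^ 2 := by rw [h3, mul_one]
  nlinarith

theorem disc_lemma {w : ℂ} {c q α β : ℝ} (hc : 0 < c) (hq : ‖w‖ ≤ q)
    (h1 : ‖w - (c : ℝ) * Complex.exp ((α : ℂ) * Complex.I)‖ ≤ q - c)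
    (h2 : ‖w - (c : ℝ) * Complex.exp ((β : ℂ) * Complex.I)‖ ≤ q - c) :
    ‖w‖ ≤ q - c * (1 - |cos ((α - β) / 2)|) := by
  have hqc : 0 < q := by linarith [norm_nonneg (w - (c : ℝ) * Complex.exp ((α : ℂ) * Complex.I))]
  have a1 := disc_lemma_sq h1
  have a2 := disc_lemma_sq h2
  set γ := (α + β) / 2
  set d := (α - β) / 2
  have eα : α = γ + d := by simp only [γ, d]; ring
  have eβ : β = γ - d := by simp only [γ, d]; ring
  have hsum : (w.re * cos α + w.im * sin α) + (w.re * cos β + w.im * sin β)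
      = 2 * cos d * (w.re * cos γ + w.im * sin γ) := by
    rw [eα, eβ, cos_add, cos_sub, sin_add, sin_sub]; ring
  have hre : |w.re * cos γ + w.im * sin γ| ≤ ‖w‖ := by
    apply abs_le_of_sq_le_sq _ (norm_nonneg _)
    rw [Complex.sq_norm, Complex.normSq_apply]
    have h3 := sin_sq_add_cos_sq γ
    have : (w.re * w.re + w.im * w.im) = (w.re ^ 2 + w.im ^ 2) * (sin γ ^ 2 + cos γ ^ 2) := by
      rw [h3]; ring
    rw [this]
    nlinarith [sq_nonneg (w.re * sin γ - w.im * cos γ)]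
  have hb : cos d * (w.re * cos γ + w.im * sin γ) ≤ |cos d| * q := by
    calc _ ≤ |cos d * (w.re * cos γ + w.im * sin γ)| := le_abs_self _
      _ = |cos d| * |w.re * cos γ + w.im * sin γ| := abs_mul _ _
      _ ≤ |cos d| * q := mul_le_mul_of_nonneg_left (hre.trans hq) (abs_nonneg _)
  have hfin : 2 * q * (c * (1 - |cos d|)) ≤ (q - ‖w‖) * (q + ‖w‖) := by
    have : c * (cos d * (w.re * cos γ + w.im * sin γ)) ≤ c * (|cos d| * q) :=
      mul_le_mul_of_nonneg_left hb hc.le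
    nlinarith
  have : (q - ‖w‖) * (q + ‖w‖) ≤ (q - ‖w‖) * (2 * q) :=
    mul_le_mul_of_nonneg_left (by linarith) (by linarith)
  have h5 : (2 * q) * (c * (1 - |cos d|)) ≤ (2 * q) * (q - ‖w‖) := by linarith
  have := le_of_mul_le_mul_left h5 (by linarith)
  linarith

theorem disc_shrink {w : ℂ} {c c' q α : ℝ} (hcc : c' ≤ c)
    (h1 : ‖w - (c : ℝ) * Complex.exp ((α : ℂ) * Complex.I)‖ ≤ q - c) :
    ‖w - (c' : ℝ) * Complex.exp ((α : ℂ) * Complex.I)‖ ≤ q - c' := by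
  have : w - (c' : ℝ) * Complex.exp ((α : ℂ) * Complex.I) =
      (w - (c : ℝ) * Complex.exp ((α : ℂ) * Complex.I)) +
        ((c - c' : ℝ) : ℂ) * Complex.exp ((α : ℂ) * Complex.I) := by push_cast; ring
  rw [this]
  refine (norm_add_le _ _).trans ?_
  rw [norm_mul, Complex.norm_exp_ofReal_mul_I, mul_one, Complex.norm_real, Real.norm_eq_abs,
    abs_of_nonneg (by linarith)]
  linarith

theorem entry_bound [Fintype X] [DecidableEq X] {Q g : X → X → ℝ} (hQ : ∀ x x', 0 ≤ Q x x')
    {m : ℕ} {x x' : X} {s₁ s₂ : ℝ} (hne : s₁ ≠ s₂) (r₁ : Reach Q g m x x' s₁)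
    (r₂ : Reach Q g m x x' s₂) :
    ∀ᶠ ε in 𝓝[>] (0 : ℝ), ∀ t : ℝ, |t| ≤ ε →
      ‖(Phi Q g t ^ m) x x'‖ ≤ ((Matrix.of Q) ^ m) x x' - ε * t ^ 2 := by
  obtain ⟨c₁, hc₁, b₁⟩ := Phi_pow_reach hQ r₁
  obtain ⟨c₂, hc₂, b₂⟩ := Phi_pow_reach hQ r₂
  set c := min c₁ c₂
  have hc : 0 < c := lt_min hc₁ hc₂
  set d := s₁ - s₂
  have hd : 0 < |d| := abs_pos.2 (sub_ne_zero.2 hne)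
  have ev1 : ∀ᶠ ε in 𝓝[>] (0 : ℝ), ε ≤ c * d ^ 2 / 32 :=
    eventually_nhdsWithin_of_eventually_nhds (eventually_le_nhds (by
      have : 0 < d ^ 2 := by rw [← sq_abs]; positivity
      positivity))
  have ev2 : ∀ᶠ ε in 𝓝[>] (0 : ℝ), ε ≤ 2 / |d| :=
    eventually_nhdsWithin_of_eventually_nhds (eventually_le_nhds (by positivity))
  filter_upwards [ev1, ev2] with ε h1 h2 t ht
  have key := disc_lemma hc (norm_Phi_pow hQ t m x x') (disc_shrink (min_le_left _ _) (b₁ t))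
    (disc_shrink (min_le_right _ _) (b₂ t))
  have ea : (t * s₁ - t * s₂) / 2 = t * d / 2 := by simp only [d]; ring
  rw [ea] at key
  have hsm : |t * d / 2| ≤ 1 := by
    rw [abs_div, abs_mul, abs_two]
    have : |t| * |d| ≤ 2 / |d| * |d| := mul_le_mul_of_nonneg_right (ht.trans h2) hd.le
    rw [div_mul_cancel₀ _ hd.ne'] at this
    linarith
  have hcos0 : 0 ≤ cos (t * d / 2) := by
    apply cos_nonneg_of_neg_pi_div_two_le_of_le <;>
      linarith [abs_le.1 hsm, pi_gt_three]
  have hcos := cos_le_one_sub_mul_cos_sq (x := t * d / 2) (by linarith [pi_gt_three])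
  have hpi : (1 : ℝ) / 8 ≤ 2 / π ^ 2 := by
    rw [div_le_div_iff₀ (by norm_num) (by positivity)]
    nlinarith [pi_lt_four, pi_pos]
  rw [abs_of_nonneg hcos0] at key
  have h3 : 1 / 8 * (t * d / 2) ^ 2 ≤ 1 - cos (t * d / 2) := by
    have := mul_le_mul_of_nonneg_right hpi (sq_nonneg (t * d / 2))
    linarith
  have h4 : c * (1 / 8 * (t * d / 2) ^ 2) ≤ c * (1 - cos (t * d / 2)) :=
    mul_le_mul_of_nonneg_left h3 hc.le
  have h5 : ε * t ^ 2 ≤ c * d ^ 2 / 32 * t ^ 2 := mul_le_mul_of_nonneg_right h1 (sq_nonneg t)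
  nlinarith

theorem row_mul [Fintype X] {A B : Matrix X X ℂ} {r s : ℝ} (hs : 0 ≤ s)
    (hA : ∀ x, ∑ x', ‖A x x'‖ ≤ r) (hB : ∀ x, ∑ x', ‖B x x'‖ ≤ s) (x : X) :
    ∑ x', ‖(A * B) x x'‖ ≤ r * s := by
  calc ∑ x', ‖(A * B) x x'‖ ≤ ∑ x', ∑ j, ‖A x j‖ * ‖B j x'‖ := by
        refine Finset.sum_le_sum fun x' _ => ?_
        rw [Matrix.mul_apply]
        refine (norm_sum_le _ _).trans (le_of_eq ?_)
        simp
    _ = ∑ j, ‖A x j‖ * ∑ x', ‖B j x'‖ := by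
        rw [Finset.sum_comm]; simp only [Finset.mul_sum]
    _ ≤ ∑ j, ‖A x j‖ * s :=
        Finset.sum_le_sum fun j _ => mul_le_mul_of_nonneg_left (hB j) (norm_nonneg _)
    _ ≤ r * s := by
        rw [← Finset.sum_mul]; exact mul_le_mul_of_nonneg_right (hA x) hs

theorem row_pow [Fintype X] [DecidableEq X] {A : Matrix X X ℂ} {r : ℝ} (hr : 0 ≤ r)
    (hA : ∀ x, ∑ x', ‖A x x'‖ ≤ r) (n : ℕ) : ∀ x, ∑ x', ‖(A ^ n) x x'‖ ≤ r ^ n := by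
  induction n with
  | zero =>
    intro x
    simp [Matrix.one_apply, apply_ite]
  | succ n ih =>
    intro x
    rw [pow_succ', pow_succ']
    exact row_mul (pow_nonneg hr n) hA ih x

theorem Good.rowPow [Fintype X] [DecidableEq X] {Q g : X → X → ℝ} {ν : X → ℝ} (h : Good Q g ν)
    (n : ℕ) : ∀ x, ∑ x', ((Matrix.of Q) ^ n) x x' = 1 := by
  induction n with
  | zero => intro x; simp [Matrix.one_apply]
  | succ n ih =>
    intro x
    simp only [pow_succ', Matrix.mul_apply]
    rw [Finset.sum_comm]
    simp only [← Finset.mul_sum, ih, mul_one, Matrix.of_apply, h.rowSum]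

theorem Good.char_bound [Fintype X] [DecidableEq X] [Nonempty X] {Q g : X → X → ℝ} {ν : X → ℝ}
    (h : Good Q g ν) : ∃ C > 0, ∃ c > 0, ∃ δ > 0, ∀ t : ℝ, |t| ≤ δ → ∀ n : ℕ, ∀ x,
      ∑ x', ‖(Phi Q g t ^ n) x x'‖ ≤ C * exp (- (c * (t ^ 2 * n))) := by
  obtain ⟨m, hm⟩ := h.nl
  have hm0 : 0 < m := by
    rcases Nat.eq_zero_or_pos m with e | e
    · subst e
      obtain ⟨x⟩ := (inferInstance : Nonempty X)
      obtain ⟨s₁, s₂, hne, r₁, r₂⟩ := hm x x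
      cases r₁; cases r₂; exact absurd rfl hne
    · exact e
  have ev : ∀ᶠ ε in 𝓝[>] (0 : ℝ), ∀ x x', ∀ t : ℝ, |t| ≤ ε →
      ‖(Phi Q g t ^ m) x x'‖ ≤ ((Matrix.of Q) ^ m) x x' - ε * t ^ 2 := by
    rw [Filter.eventually_all]; intro x
    rw [Filter.eventually_all]; intro x'
    obtain ⟨s₁, s₂, hne, r₁, r₂⟩ := hm x x'
    exact entry_bound h.nonneg hne r₁ r₂
  obtain ⟨ε, hb, hε⟩ := (ev.and self_mem_nhdsWithin).exists
  have hε : 0 < ε := hε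
  refine ⟨exp (ε * ε ^ 2), exp_pos _, ε / m, by positivity, ε, hε, fun t ht n x => ?_⟩
  have row : ∀ x, ∑ x', ‖(Phi Q g t ^ m) x x'‖ ≤ exp (-(ε * t ^ 2)) := by
    intro x
    calc _ ≤ ∑ x', (((Matrix.of Q) ^ m) x x' - ε * t ^ 2) :=
          Finset.sum_le_sum fun x' _ => hb x x' t ht
      _ = 1 - Fintype.card X * (ε * t ^ 2) := by
          rw [Finset.sum_sub_distrib, h.rowPow]; simp
      _ ≤ 1 - ε * t ^ 2 := by
          have h1 : (1 : ℝ) ≤ Fintype.card X := by exact_mod_cast Fintype.card_pos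
          have h2 : 0 ≤ ε * t ^ 2 := by positivity
          nlinarith
      _ ≤ _ := by have := add_one_le_exp (-(ε * t ^ 2)); linarith
  have row1 : ∀ x, ∑ x', ‖(Phi Q g t) x x'‖ ≤ 1 := by
    intro x; simp only [norm_Phi h.nonneg, h.rowSum, le_refl]
  have hn : Phi Q g t ^ n = (Phi Q g t ^ m) ^ (n / m) * (Phi Q g t) ^ (n % m) := by
    rw [← pow_mul, ← pow_add, Nat.div_add_mod]
  rw [hn]
  have r2 := row_mul (x := x) (by simp) (row_pow (exp_pos _).le row (n / m))
    (row_pow zero_le_one row1 (n % m))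
  refine r2.trans ?_
  rw [one_pow, mul_one, ← Real.exp_nat_mul, ← Real.exp_add]
  apply exp_le_exp.2
  have hdm : (n : ℝ) / m - 1 ≤ ((n / m : ℕ) : ℝ) := by
    have h1 : n < m * (n / m + 1) := Nat.lt_mul_div_succ n hm0
    have h2 : (n : ℝ) ≤ m * (((n / m : ℕ) : ℝ) + 1) := by exact_mod_cast h1.le
    have hmr : (0 : ℝ) < m := by exact_mod_cast hm0
    rw [sub_le_iff_le_add, div_le_iff₀ hmr]; linarith
  have ht2 : t ^ 2 ≤ ε ^ 2 := sq_le_sq' (by linarith [(abs_le.1 ht).1]) (abs_le.1 ht).2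
  have h1 : ε * t ^ 2 * ((n : ℝ) / m - 1) ≤ ε * t ^ 2 * ((n / m : ℕ) : ℝ) :=
    mul_le_mul_of_nonneg_left hdm (by positivity)
  have h2 : ε * t ^ 2 ≤ ε * ε ^ 2 := mul_le_mul_of_nonneg_left ht2 hε.le
  have h3 : ε / m * (t ^ 2 * n) = ε * t ^ 2 * ((n : ℝ) / m) := by ring
  rw [h3]
  linarith

/-! ## Free and killed transition operators -/

theorem ind_nonneg (p : Prop) : 0 ≤ ind p := by unfold ind; split_ifs <;> simp

theorem ind_le_one (p : Prop) : ind p ≤ 1 := by unfold ind; split_ifs <;> simp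

theorem ind_true {p : Prop} (h : p) : ind p = 1 := by simp [ind, h]

theorem ind_false {p : Prop} (h : ¬ p) : ind p = 0 := by simp [ind, h]

/-- Free transition operator. -/
noncomputable def Uw [Fintype X] (Q g : X → X → ℝ) : Module.End ℝ (X → ℝ → ℝ) where
  toFun G := fun x y => ∑ x', Q x x' * G x' (y + g x x')
  map_add' G H := by
    funext x y
    simp [mul_add, Finset.sum_add_distrib]
  map_smul' c G := by
    funext x y
    simp only [Pi.smul_apply, smul_eq_mul, RingHom.id_apply, Finset.mul_sum]
    exact Finset.sum_congr rfl fun _ _ => by ring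

/-- Transition operator killed when leaving the positive half-line. -/
noncomputable def Tw [Fintype X] (Q g : X → X → ℝ) : Module.End ℝ (X → ℝ → ℝ) where
  toFun G := fun x y => ∑ x', Q x x' * (ind (0 < y + g x x') * G x' (y + g x x'))
  map_add' G H := by
    funext x y
    simp [mul_add, Finset.sum_add_distrib]
  map_smul' c G := by
    funext x y
    simp only [Pi.smul_apply, smul_eq_mul, RingHom.id_apply, Finset.mul_sum]
    exact Finset.sum_congr rfl fun _ _ => by ring

section ops

variable [Fintype X] {Q g : X → X → ℝ}

theorem Uw_apply (G : X → ℝ → ℝ) (x : X) (y : ℝ) :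
    Uw Q g G x y = ∑ x', Q x x' * G x' (y + g x x') := rfl

theorem Tw_apply (G : X → ℝ → ℝ) (x : X) (y : ℝ) :
    Tw Q g G x y = ∑ x', Q x x' * (ind (0 < y + g x x') * G x' (y + g x x')) := rfl

theorem Uw_succ (n : ℕ) (G : X → ℝ → ℝ) : (Uw Q g ^ (n + 1)) G = Uw Q g ((Uw Q g ^ n) G) := by
  rw [pow_succ']; rfl

theorem Tw_succ (n : ℕ) (G : X → ℝ → ℝ) : (Tw Q g ^ (n + 1)) G = Tw Q g ((Tw Q g ^ n) G) := by
  rw [pow_succ']; rfl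

theorem Tw_succ' (n : ℕ) (G : X → ℝ → ℝ) : (Tw Q g ^ (n + 1)) G = (Tw Q g ^ n) (Tw Q g G) := by
  rw [pow_succ]; rfl

theorem Tw_add (n m : ℕ) (G : X → ℝ → ℝ) :
    (Tw Q g ^ (n + m)) G = (Tw Q g ^ n) ((Tw Q g ^ m) G) := by
  rw [pow_add]; rfl

theorem Uw_mono (hQ : ∀ x x', 0 ≤ Q x x') (n : ℕ) {G H : X → ℝ → ℝ} (h : ∀ x y, G x y ≤ H x y) :
    ∀ x y, (Uw Q g ^ n) G x y ≤ (Uw Q g ^ n) H x y := by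
  induction n with
  | zero => simpa using h
  | succ n ih =>
    intro x y
    rw [Uw_succ, Uw_succ, Uw_apply, Uw_apply]
    exact Finset.sum_le_sum fun j _ => mul_le_mul_of_nonneg_left (ih _ _) (hQ _ _)

theorem Tw_mono1 (hQ : ∀ x x', 0 ≤ Q x x') {G H : X → ℝ → ℝ}
    (h : ∀ x y, 0 < y → G x y ≤ H x y) :
    ∀ x y, Tw Q g G x y ≤ Tw Q g H x y := by
  intro x y
  rw [Tw_apply, Tw_apply]
  refine Finset.sum_le_sum fun j _ => mul_le_mul_of_nonneg_left ?_ (hQ _ _)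
  by_cases hp : 0 < y + g x j
  · rw [ind_true hp, one_mul, one_mul]; exact h _ _ hp
  · rw [ind_false hp, zero_mul, zero_mul]

theorem Tw_mono (hQ : ∀ x x', 0 ≤ Q x x') (n : ℕ) {G H : X → ℝ → ℝ}
    (h : ∀ x y, G x y ≤ H x y) :
    ∀ x y, (Tw Q g ^ n) G x y ≤ (Tw Q g ^ n) H x y := by
  induction n with
  | zero => simpa using h
  | succ n ih =>
    intro x y
    rw [Tw_succ, Tw_succ]
    exact Tw_mono1 hQ (fun x y _ => ih x y) x y

theorem Tw_mono' (hQ : ∀ x x', 0 ≤ Q x x') {n : ℕ} (hn : 1 ≤ n) {G H : X → ℝ → ℝ}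
    (h : ∀ x y, 0 < y → G x y ≤ H x y) :
    ∀ x y, (Tw Q g ^ n) G x y ≤ (Tw Q g ^ n) H x y := by
  obtain ⟨k, rfl⟩ : ∃ k, n = k + 1 := ⟨n - 1, by omega⟩
  rw [Tw_succ', Tw_succ']
  exact Tw_mono hQ k (Tw_mono1 hQ h)

theorem Tw_nonneg (hQ : ∀ x x', 0 ≤ Q x x') (n : ℕ) {G : X → ℝ → ℝ}
    (h : ∀ x y, 0 ≤ G x y) (x : X) (y : ℝ) : 0 ≤ (Tw Q g ^ n) G x y := by
  have := Tw_mono (g := g) hQ n (G := 0) (H := G) h x y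
  simpa using this

theorem Tw_le_Uw (hQ : ∀ x x', 0 ≤ Q x x') (n : ℕ) {G : X → ℝ → ℝ}
    (h : ∀ x y, 0 ≤ G x y) : ∀ x y, (Tw Q g ^ n) G x y ≤ (Uw Q g ^ n) G x y := by
  induction n with
  | zero => intro x y; simp
  | succ n ih =>
    intro x y
    rw [Tw_succ, Uw_succ, Tw_apply, Uw_apply]
    refine Finset.sum_le_sum fun j _ => mul_le_mul_of_nonneg_left ?_ (hQ _ _)
    refine le_trans ?_ (ih _ _)
    exact mul_le_of_le_one_left (Tw_nonneg hQ n h _ _) (ind_le_one _)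

theorem Uw_const (hr : ∀ x, ∑ x', Q x x' = 1) (n : ℕ) (c : ℝ) :
    (Uw Q g ^ n) (fun _ _ => c) = fun _ _ => c := by
  induction n with
  | zero => simp
  | succ n ih =>
    rw [Uw_succ, ih]
    funext x y
    rw [Uw_apply, ← Finset.sum_mul, hr, one_mul]

theorem Uw_cos [DecidableEq X] (n : ℕ) (t b : ℝ) : ∀ x y,
    (Uw Q g ^ n) (fun _ y => cos (t * y - b)) x y =
      (Complex.exp (((t * y - b : ℝ) : ℂ) * Complex.I) * ∑ x', (Phi Q g t ^ n) x x').re := by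
  induction n with
  | zero =>
    intro x y
    simp only [pow_zero, Module.End.one_apply, Matrix.one_apply, Finset.sum_ite_eq,
      Finset.mem_univ, if_true, mul_one, Complex.exp_ofReal_mul_I_re]
  | succ n ih =>
    intro x y
    rw [Uw_succ, Uw_apply]
    simp only [ih, pow_succ', Matrix.mul_apply]
    rw [Finset.sum_comm, Finset.mul_sum, Complex.re_sum]
    refine Finset.sum_congr rfl fun j _ => ?_
    rw [← Complex.re_ofReal_mul]
    congr 1
    simp only [Phi, Matrix.of_apply, ← Finset.mul_sum]
    have : Complex.exp (((t * (y + g x j) - b : ℝ) : ℂ) * Complex.I) =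
        Complex.exp (((t * y - b : ℝ) : ℂ) * Complex.I) *
          Complex.exp (((t * g x j : ℝ) : ℂ) * Complex.I) := by
      rw [← Complex.exp_add]; congr 1; push_cast; ring
    rw [this]; ring

theorem Uw_cos_le [DecidableEq X] (n : ℕ) (t b : ℝ) (x : X) (y : ℝ) :
    (Uw Q g ^ n) (fun _ y => cos (t * y - b)) x y ≤ ∑ x', ‖(Phi Q g t ^ n) x x'‖ := by
  rw [Uw_cos]
  refine (Complex.re_le_norm _).trans ?_
  rw [norm_mul, Complex.norm_exp_ofReal_mul_I, one_mul]
  exact norm_sum_le _ _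

end ops

theorem gauss_sum_bound {c : ℝ} (hc : 0 < c) : ∃ C > 0, ∀ (N : ℕ) (j : ℕ),
    ∑ k ∈ Finset.range N, exp (-(c * ((j : ℝ) - k) ^ 2)) ≤ C := by
  have hs1 : Summable (fun n : ℕ => exp (-(c * ((n : ℝ)) ^ 2))) := by
    refine Summable.of_nonneg_of_le (fun _ => (exp_pos _).le) (fun n => ?_)
      (summable_geometric_of_lt_one (exp_pos (-c)).le (by rw [Real.exp_lt_one_iff]; linarith))
    rw [← Real.exp_nat_mul]
    apply exp_le_exp.2
    have : (n : ℝ) ≤ (n : ℝ) ^ 2 := by exact_mod_cast Nat.le_self_pow two_ne_zero n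
    nlinarith
  have hs : Summable (fun l : ℤ => exp (-(c * ((l : ℝ)) ^ 2))) := by
    refine Summable.of_nat_of_neg ?_ ?_ <;> simpa using hs1
  refine ⟨∑' l : ℤ, exp (-(c * ((l : ℝ)) ^ 2)) + 1, ?_, fun N j => ?_⟩
  · have : 0 ≤ ∑' l : ℤ, exp (-(c * ((l : ℝ)) ^ 2)) := tsum_nonneg fun _ => (exp_pos _).le
    linarith
  · have inj : Function.Injective (fun k : ℕ => (j : ℤ) - k) := by
      intro a b h; simpa using h
    have := hs.sum_le_tsum ((Finset.range N).map ⟨_, inj⟩) (fun _ _ => (exp_pos _).le)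
    rw [Finset.sum_map] at this
    simp only [Function.Embedding.coeFn_mk] at this
    push_cast at this
    linarith

theorem kernel_lower {N : ℕ} {τ v : ℝ} (h : ∀ j < N, |j * τ * v| ≤ 1) :
    (N : ℝ) ^ 2 / 4 ≤ ∑ j ∈ Finset.range N, ∑ k ∈ Finset.range N,
      cos ((((j : ℝ) - k) * τ) * v) := by
  have e : ∑ j ∈ Finset.range N, ∑ k ∈ Finset.range N, cos ((((j : ℝ) - k) * τ) * v) =
      (∑ j ∈ Finset.range N, cos (j * τ * v)) ^ 2 +
        (∑ j ∈ Finset.range N, sin (j * τ * v)) ^ 2 := by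
    rw [sq, sq, Finset.sum_mul_sum, Finset.sum_mul_sum, ← Finset.sum_add_distrib]
    refine Finset.sum_congr rfl fun j _ => ?_
    rw [← Finset.sum_add_distrib]
    refine Finset.sum_congr rfl fun k _ => ?_
    rw [← cos_sub]; congr 1; ring
  rw [e]
  have h1 : (N : ℝ) / 2 ≤ ∑ j ∈ Finset.range N, cos (j * τ * v) := by
    calc (N : ℝ) / 2 = ∑ j ∈ Finset.range N, (1 / 2 : ℝ) := by simp; ring
      _ ≤ _ := by
        refine Finset.sum_le_sum fun j hj => ?_
        have h2 := h j (Finset.mem_range.1 hj)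
        have h3 := one_sub_sq_div_two_le_cos (x := (j : ℝ) * τ * v)
        have h4 : ((j : ℝ) * τ * v) ^ 2 ≤ 1 := by
          rw [← sq_abs]; nlinarith [abs_nonneg ((j : ℝ) * τ * v)]
        linarith
  have h5 : ((N : ℝ) / 2) ^ 2 ≤ (∑ j ∈ Finset.range N, cos (j * τ * v)) ^ 2 :=
    pow_le_pow_left₀ (by positivity) h1 2
  have h6 := sq_nonneg (∑ j ∈ Finset.range N, sin (j * τ * v))
  nlinarith

theorem kernel_nonneg {N : ℕ} {τ v : ℝ} :
    0 ≤ ∑ j ∈ Finset.range N, ∑ k ∈ Finset.range N, cos ((((j : ℝ) - k) * τ) * v) := by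
  have e : ∑ j ∈ Finset.range N, ∑ k ∈ Finset.range N, cos ((((j : ℝ) - k) * τ) * v) =
      (∑ j ∈ Finset.range N, cos (j * τ * v)) ^ 2 +
        (∑ j ∈ Finset.range N, sin (j * τ * v)) ^ 2 := by
    rw [sq, sq, Finset.sum_mul_sum, Finset.sum_mul_sum, ← Finset.sum_add_distrib]
    refine Finset.sum_congr rfl fun j _ => ?_
    rw [← Finset.sum_add_distrib]
    refine Finset.sum_congr rfl fun k _ => ?_
    rw [← cos_sub]; congr 1; ring
  rw [e]; positivity

/-- Concentration bound for the free walk. -/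
theorem Good.conc [Fintype X] [DecidableEq X] [Nonempty X] {Q g : X → X → ℝ} {ν : X → ℝ}
    (h : Good Q g ν) : ∃ C > 0, ∀ n : ℕ, 1 ≤ n → ∀ b : ℝ, 0 ≤ b → ∀ u x y,
      (Uw Q g ^ n) (fun _ y => ind (y ∈ Set.Icc u (u + b))) x y ≤ C * (1 + b) / √n := by
  obtain ⟨C0, hC0, c, hc, δ, hδ, hch⟩ := h.char_bound
  obtain ⟨C2, hC2, hg⟩ := gauss_sum_bound hc
  refine ⟨(1 + 8 * C0 * C2) * (1 / δ + 1), by positivity, fun n hn b hb u x y => ?_⟩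
  have hnR : (0 : ℝ) < n := by exact_mod_cast hn
  have hsn : 0 < √(n : ℝ) := sqrt_pos.2 hnR
  have hsq : √(n : ℝ) ^ 2 = n := sq_sqrt hnR.le
  set D := 1 / δ + b with hD
  have hDpos : 0 < D := by positivity
  have hDle : D ≤ (1 / δ + 1) * (1 + b) := by
    have : 0 < 1 / δ := by positivity
    simp only [hD]; nlinarith
  suffices hs : (Uw Q g ^ n) (fun _ y => ind (y ∈ Set.Icc u (u + b))) x y ≤
      (1 + 8 * C0 * C2) * D / √n by
    refine hs.trans ?_
    rw [mul_assoc (1 + 8 * C0 * C2)]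
    gcongr
  by_cases hcase : √(n : ℝ) < D
  · have h1 := Uw_mono (g := g) h.nonneg n (G := fun _ y => ind (y ∈ Set.Icc u (u + b)))
      (H := fun _ _ => 1) (fun _ _ => ind_le_one _) x y
    rw [Uw_const h.rowSum] at h1
    refine h1.trans ?_
    rw [le_div_iff₀ hsn]
    have : 0 < 8 * C0 * C2 * D := by positivity
    nlinarith
  push Not at hcase
  set N := ⌊√(n : ℝ) / D⌋₊ with hN
  have hq1 : 1 ≤ √(n : ℝ) / D := (one_le_div hDpos).2 hcase
  have hN1 : 1 ≤ N := Nat.le_floor (by simpa using hq1)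
  have hNle : (N : ℝ) ≤ √n / D := Nat.floor_le (by positivity)
  have hNR : (1 : ℝ) ≤ N := by exact_mod_cast hN1
  have hNge : √n / D ≤ 2 * N := by
    have := Nat.lt_floor_add_one (√(n : ℝ) / D)
    rw [← hN] at this
    linarith
  set τ := 1 / √(n : ℝ) with hτ
  have hτpos : 0 < τ := by positivity
  have hNτ : N * τ ≤ 1 / D := by
    rw [hτ, mul_one_div, div_le_iff₀ hsn]
    calc (N : ℝ) ≤ √n / D := hNle
      _ = _ := by ring
  -- pointwise domination
  have dom : ∀ (x : X) (y : ℝ), ind (y ∈ Set.Icc u (u + b)) ≤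
      ((4 / (N : ℝ) ^ 2) • ∑ j ∈ Finset.range N, ∑ k ∈ Finset.range N,
        (fun (_ : X) (y : ℝ) => cos ((((j : ℝ) - k) * τ) * y - (((j : ℝ) - k) * τ) * u))) x y := by
    intro x y
    simp only [Pi.smul_apply, Finset.sum_apply, smul_eq_mul, ← mul_sub]
    by_cases hy : y ∈ Set.Icc u (u + b)
    · rw [ind_true hy]
      have hv : |y - u| ≤ b := by
        rw [abs_of_nonneg (by linarith [hy.1])]; linarith [hy.2]
      have := kernel_lower (N := N) (τ := τ) (v := y - u) (by
        intro j hj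
        rw [abs_mul, abs_of_nonneg (by positivity : (0 : ℝ) ≤ j * τ)]
        have hj' : (j : ℝ) ≤ N := by exact_mod_cast hj.le
        calc (j : ℝ) * τ * |y - u| ≤ (N * τ) * b := by gcongr
          _ ≤ 1 / D * b := by gcongr
          _ ≤ 1 := by
            rw [one_div_mul_eq_div, div_le_one hDpos]
            have : 0 < 1 / δ := by positivity
            linarith)
      calc (1 : ℝ) = 4 / (N : ℝ) ^ 2 * ((N : ℝ) ^ 2 / 4) := by field_simp
        _ ≤ _ := by gcongr
    · rw [ind_false hy]
      exact mul_nonneg (by positivity) kernel_nonneg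
  refine (Uw_mono h.nonneg n dom x y).trans ?_
  rw [map_smul, map_sum]
  simp only [map_sum, Pi.smul_apply, Finset.sum_apply, smul_eq_mul]
  have bd : ∀ j ∈ Finset.range N, ∀ k ∈ Finset.range N,
      (Uw Q g ^ n) (fun (_ : X) (y : ℝ) =>
        cos ((((j : ℝ) - k) * τ) * y - (((j : ℝ) - k) * τ) * u)) x y ≤
      C0 * exp (-(c * ((j : ℝ) - k) ^ 2)) := by
    intro j hj k hk
    refine (Uw_cos_le n _ _ x y).trans ?_
    have hj' : (j : ℝ) ≤ N := by exact_mod_cast (Finset.mem_range.1 hj).le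
    have hk' : (k : ℝ) ≤ N := by exact_mod_cast (Finset.mem_range.1 hk).le
    have hj0 : (0 : ℝ) ≤ j := by positivity
    have hk0 : (0 : ℝ) ≤ k := by positivity
    have ht : |((j : ℝ) - k) * τ| ≤ δ := by
      rw [abs_mul, abs_of_pos hτpos]
      calc |(j : ℝ) - k| * τ ≤ N * τ := by
            gcongr; rw [abs_le]; constructor <;> linarith
        _ ≤ 1 / D := hNτ
        _ ≤ δ := by
          rw [div_le_iff₀ hDpos, hD, mul_add, mul_one_div_cancel hδ.ne']
          have : 0 ≤ δ * b := by positivity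
          linarith
    have := hch _ ht n x
    have e : (((j : ℝ) - k) * τ) ^ 2 * n = ((j : ℝ) - k) ^ 2 := by
      rw [hτ, mul_pow, div_pow, hsq]; field_simp
    rwa [e] at this
  calc 4 / (N : ℝ) ^ 2 * ∑ j ∈ Finset.range N, ∑ k ∈ Finset.range N,
      (Uw Q g ^ n) (fun (_ : X) (y : ℝ) =>
        cos ((((j : ℝ) - k) * τ) * y - (((j : ℝ) - k) * τ) * u)) x y
      ≤ 4 / (N : ℝ) ^ 2 * ∑ j ∈ Finset.range N, ∑ k ∈ Finset.range N,
        C0 * exp (-(c * ((j : ℝ) - k) ^ 2)) := by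
        gcongr with j hj k hk
        exact bd j hj k hk
    _ ≤ 4 / (N : ℝ) ^ 2 * ∑ j ∈ Finset.range N, C0 * C2 := by
        gcongr with j hj
        rw [← Finset.mul_sum]
        gcongr
        exact hg N j
    _ = 4 * C0 * C2 / N := by
        rw [Finset.sum_const, Finset.card_range, nsmul_eq_mul]; field_simp
    _ ≤ 8 * C0 * C2 * D / √n := by
        rw [div_le_div_iff₀ (by linarith) hsn]
        rw [div_le_iff₀ hDpos] at hNge
        have : 0 < 4 * C0 * C2 := by positivity
        calc 4 * C0 * C2 * √n ≤ 4 * C0 * C2 * (2 * N * D) := by gcongr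
          _ = _ := by ring
    _ ≤ (1 + 8 * C0 * C2) * D / √n := by
        gcongr; linarith

/-! ## Poisson equation -/

theorem Good.pow_pos [Fintype X] [DecidableEq X] {Q g : X → X → ℝ} {ν : X → ℝ}
    (h : Good Q g ν) : ∃ m : ℕ, ∀ x x', 0 < ((Matrix.of Q) ^ m) x x' := by
  obtain ⟨m, hm⟩ := h.nl
  refine ⟨m, fun x x' => ?_⟩
  obtain ⟨s₁, s₂, -, r₁, -⟩ := hm x x'
  obtain ⟨c, hc, hb⟩ := Phi_pow_reach h.nonneg r₁
  have := (norm_nonneg _).trans (hb 0)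
  linarith

theorem Good.harmonic_const [Fintype X] [DecidableEq X] [Nonempty X] {Q g : X → X → ℝ}
    {ν : X → ℝ} (h : Good Q g ν) (v : X → ℝ) (hv : ∀ x, ∑ x', Q x x' * v x' = v x) :
    ∃ c : ℝ, v = fun _ => c := by
  obtain ⟨m, hm⟩ := h.pow_pos
  have hpow : ∀ n : ℕ, ∀ x, ∑ x', ((Matrix.of Q) ^ n) x x' * v x' = v x := by
    intro n
    induction n with
    | zero => intro x; simp [Matrix.one_apply]
    | succ n ih =>
      intro x
      simp only [pow_succ', Matrix.mul_apply, Finset.sum_mul]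
      rw [Finset.sum_comm]
      simp only [mul_assoc, ← Finset.mul_sum, ih, Matrix.of_apply, hv]
  obtain ⟨x0, hx0⟩ := Finite.exists_max v
  refine ⟨v x0, funext fun x' => ?_⟩
  have hz : ∑ x', ((Matrix.of Q) ^ m) x0 x' * (v x0 - v x') = 0 := by
    simp only [mul_sub, Finset.sum_sub_distrib, hpow, ← Finset.sum_mul, h.rowPow]; ring
  have := (Finset.sum_eq_zero_iff_of_nonneg (fun x' _ =>
    mul_nonneg (hm x0 x').le (sub_nonneg.2 (hx0 x')))).1 hz x' (Finset.mem_univ _)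
  rcases mul_eq_zero.1 this with h1 | h1
  · exact absurd h1 (hm x0 x').ne'
  · linarith

theorem Good.poisson [Fintype X] [DecidableEq X] [Nonempty X] {Q g : X → X → ℝ} {ν : X → ℝ}
    (h : Good Q g ν) : ∃ p : X → ℝ, ∀ x, ∑ x', Q x x' * (g x x' + p x') = p x := by
  let L : (X → ℝ) →ₗ[ℝ] (X → ℝ) := LinearMap.id - (Matrix.of Q).mulVecLin
  let φ : (X → ℝ) →ₗ[ℝ] ℝ := ∑ x, ν x • LinearMap.proj x
  have hL : ∀ v x, L v x = v x - ∑ x', Q x x' * v x' := by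
    intro v x; simp [L, Matrix.mulVec, dotProduct]
  have hφ : ∀ v, φ v = ∑ x, ν x * v x := by intro v; simp [φ]
  have hle : LinearMap.range L ≤ LinearMap.ker φ := by
    rintro _ ⟨v, rfl⟩
    rw [LinearMap.mem_ker, hφ]
    simp only [hL, mul_sub, Finset.sum_sub_distrib, Finset.mul_sum]
    rw [sub_eq_zero, Finset.sum_comm]
    refine Finset.sum_congr rfl fun x' _ => ?_
    rw [← h.nuInv x', Finset.sum_mul]
    exact Finset.sum_congr rfl fun x _ => by ring
  have hker : Module.finrank ℝ (LinearMap.ker L) ≤ 1 := by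
    have : LinearMap.ker L ≤ Submodule.span ℝ {(fun _ => 1 : X → ℝ)} := by
      intro v hv
      rw [LinearMap.mem_ker] at hv
      obtain ⟨c, rfl⟩ := h.harmonic_const v (fun x => by
        have := congrFun hv x
        rw [hL] at this
        simp only [Pi.zero_apply] at this
        linarith)
      rw [Submodule.mem_span_singleton]
      exact ⟨c, by funext; simp⟩
    exact (Submodule.finrank_mono this).trans ((finrank_span_le_card _).trans (by simp))
  have hsurj : LinearMap.range φ = ⊤ := by
    rw [LinearMap.range_eq_top]
    have hpos : 0 < ∑ x, ν x := Finset.sum_pos (fun x _ => h.nuPos x) Finset.univ_nonempty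
    intro r
    refine ⟨fun _ => r / ∑ x, ν x, ?_⟩
    rw [hφ, ← Finset.sum_mul]
    field_simp
  have d1 := LinearMap.finrank_range_add_finrank_ker L
  have d2 := LinearMap.finrank_range_add_finrank_ker φ
  rw [hsurj, finrank_top, Module.finrank_self] at d2
  have heq : LinearMap.range L = LinearMap.ker φ :=
    Submodule.eq_of_le_of_finrank_le hle (by omega)
  have hF : (fun x => ∑ x', Q x x' * g x x') ∈ LinearMap.range L := by
    rw [heq, LinearMap.mem_ker, hφ, ← h.mean]
    refine Finset.sum_congr rfl fun x _ => ?_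
    rw [Finset.mul_sum]
    exact Finset.sum_congr rfl fun x' _ => by ring
  obtain ⟨p, hp⟩ := hF
  refine ⟨p, fun x => ?_⟩
  have := congrFun hp x
  rw [hL] at this
  simp only [mul_add, Finset.sum_add_distrib]
  linarith

/-! ## Survival bound -/

/-- A function growing linearly which is superharmonic for the killed walk. -/
theorem Good.superharm [Fintype X] [DecidableEq X] [Nonempty X] {Q g : X → X → ℝ} {ν : X → ℝ}
    (h : Good Q g ν) : ∃ A > 0, ∃ q : X → ℝ, (∀ x, 0 ≤ q x) ∧ (∀ x, q x ≤ A) ∧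
      ∀ n x y, (Tw Q g ^ n) (fun x y => y + q x) x y ≤ max y 0 + A := by
  obtain ⟨p, hp⟩ := h.poisson
  obtain ⟨B, hB0, hB⟩ : ∃ B : ℝ, 0 < B ∧ ∀ x, |p x| ≤ B := by
    refine ⟨∑ x, |p x| + 1, by positivity, fun x => ?_⟩
    have := Finset.single_le_sum (f := fun x => |p x|) (fun x _ => abs_nonneg _) (Finset.mem_univ x)
    linarith
  obtain ⟨Γ, hΓ0, hΓ⟩ : ∃ Γ : ℝ, 0 < Γ ∧ ∀ x x', |g x x'| ≤ Γ := by
    refine ⟨∑ x, ∑ x', |g x x'| + 1, by positivity, fun x x' => ?_⟩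
    have h1 := Finset.single_le_sum (f := fun x' => |g x x'|) (fun x _ => abs_nonneg _)
      (Finset.mem_univ x')
    have h2 := Finset.single_le_sum (f := fun x => ∑ x', |g x x'|)
      (fun x _ => Finset.sum_nonneg fun _ _ => abs_nonneg _) (Finset.mem_univ x)
    linarith
  refine ⟨2 * B + Γ, by positivity, fun x => p x + B + Γ, fun x => ?_, fun x => ?_, ?_⟩
  · linarith [(abs_le.1 (hB x)).1]
  · linarith [(abs_le.1 (hB x)).2]
  have key : ∀ n x y, (Tw Q g ^ n) (fun x y => y + (p x + B + Γ)) x y ≤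
      max y 0 + (p x + B + Γ) := by
    intro n
    induction n with
    | zero => intro x y; simp
    | succ n ih =>
      intro x y
      rw [Tw_succ, Tw_apply]
      have e : max y 0 + (p x + B + Γ) =
          ∑ x', Q x x' * ((max y 0 + g x x') + (p x' + B + Γ)) := by
        have e1 : ∀ x', Q x x' * ((max y 0 + g x x') + (p x' + B + Γ)) =
            Q x x' * (g x x' + p x') + Q x x' * (max y 0 + B + Γ) := fun x' => by ring
        simp only [e1, Finset.sum_add_distrib, hp, ← Finset.sum_mul, h.rowSum]
        ring
      rw [e]
      refine Finset.sum_le_sum fun x' _ => mul_le_mul_of_nonneg_left ?_ (h.nonneg _ _)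
      have hb1 := (abs_le.1 (hB x')).1
      have hg1 := (abs_le.1 (hΓ x x')).1
      have hm0 := le_max_right y 0
      have hmy := le_max_left y 0
      by_cases hpos : 0 < y + g x x'
      · rw [ind_true hpos, one_mul]
        have := ih x' (y + g x x')
        rw [max_eq_left hpos.le] at this
        linarith
      · rw [ind_false hpos, zero_mul]
        linarith
  intro n x y
  have := key n x y
  linarith [(abs_le.1 (hB x)).2]

theorem Tw_one_le [Fintype X] {Q g : X → X → ℝ} (hQ : ∀ x x', 0 ≤ Q x x')
    (hr : ∀ x, ∑ x', Q x x' = 1) (n : ℕ) (x : X) (y : ℝ) :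
    (Tw Q g ^ n) (fun _ _ => 1) x y ≤ 1 := by
  have := Tw_le_Uw (g := g) hQ n (G := fun _ _ => 1) (fun _ _ => zero_le_one) x y
  rwa [Uw_const hr] at this

theorem Tw_le_const [Fintype X] {Q g : X → X → ℝ} (hQ : ∀ x x', 0 ≤ Q x x')
    (n : ℕ) {G : X → ℝ → ℝ} {c : ℝ} (hG : ∀ x y, G x y ≤ c) (x : X) (y : ℝ) :
    (Tw Q g ^ n) G x y ≤ c * (Tw Q g ^ n) (fun _ _ => 1) x y := by
  have h1 := Tw_mono (g := g) hQ n (G := G) (H := c • (fun _ _ => 1)) (fun x y => by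
    simpa using hG x y) x y
  rw [map_smul] at h1
  simpa using h1

theorem Good.survival [Fintype X] [DecidableEq X] [Nonempty X] {Q g : X → X → ℝ} {ν : X → ℝ}
    (h : Good Q g ν) : ∃ K > 0, ∀ n : ℕ, 1 ≤ n → ∀ x y,
      (Tw Q g ^ n) (fun _ _ => 1) x y ≤ K * (1 + max y 0) / √n := by
  obtain ⟨C, hC, hconc⟩ := h.conc
  obtain ⟨A, hA, q, hq0, hqA, hsup⟩ := h.superharm
  -- choose ε with 4 C ε = 1/4 and N0 = (16 C)^2
  set ε := 1 / (16 * C) with hε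
  have hεpos : 0 < ε := by positivity
  set K := max (max (16 * C) 2) (2 * (1 + A) / ε) with hK
  have hKC : 16 * C ≤ K := (le_max_left _ _).trans (le_max_left _ _)
  have hK2 : 2 ≤ K := (le_max_right _ _).trans (le_max_left _ _)
  have hKA : 2 * (1 + A) / ε ≤ K := le_max_right _ _
  have hKpos : 0 < K := by linarith
  refine ⟨K, hKpos, fun n => ?_⟩
  induction n using Nat.strong_induction_on with
  | _ n IH =>
  intro hn x y
  have hnR : (0 : ℝ) < n := by exact_mod_cast hn
  have hsn : 0 < √(n : ℝ) := sqrt_pos.2 hnR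
  have hY : 1 ≤ 1 + max y 0 := by linarith [le_max_right y 0]
  by_cases hsmall : √(n : ℝ) ≤ K ∧ (√(n : ℝ) ≤ 16 * C ∨ n = 1)
  · refine (Tw_one_le h.nonneg h.rowSum n x y).trans ?_
    rw [le_div_iff₀ hsn]
    nlinarith [hsmall.1]
  have hbig : 16 * C < √(n : ℝ) ∧ 2 ≤ n := by
    constructor
    · by_contra hc
      push Not at hc
      exact hsmall ⟨hc.trans hKC, Or.inl hc⟩
    · by_contra hc
      have : n = 1 := by omega
      subst this
      exact hsmall ⟨by simp; linarith, Or.inr rfl⟩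
  obtain ⟨hbC, hn2⟩ := hbig
  set m := n / 2 with hm
  have hm1 : 1 ≤ m := by omega
  have hmn : (n - m) + m = n := by omega
  set B := ε * √(n : ℝ) with hB
  have hBpos : 0 < B := by positivity
  -- domination
  have d1 : (Tw Q g ^ n) (fun _ _ => 1) x y ≤
      (Tw Q g ^ n) ((1 / B) • (fun x y => y + q x) +
        (fun _ y => ind (y ∈ Set.Icc 0 (0 + B)))) x y := by
    refine Tw_mono' h.nonneg hn (fun x y hy => ?_) x y
    simp only [Pi.add_apply, Pi.smul_apply, smul_eq_mul, zero_add]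
    have hq := hq0 x
    by_cases hyB : y ≤ B
    · rw [ind_true ⟨hy.le, hyB⟩]
      have : 0 ≤ 1 / B * (y + q x) := by positivity
      linarith
    · push Not at hyB
      have h1 : 1 ≤ 1 / B * (y + q x) := by
        rw [one_div_mul_eq_div, le_div_iff₀ hBpos]; linarith
      linarith [ind_nonneg (y ∈ Set.Icc 0 B)]
  rw [map_add, map_smul] at d1
  simp only [Pi.add_apply, Pi.smul_apply, smul_eq_mul] at d1
  have d2 : (Tw Q g ^ n) (fun _ y => ind (y ∈ Set.Icc 0 (0 + B))) x y ≤
      C * (1 + B) / √m * (Tw Q g ^ (n - m)) (fun _ _ => 1) x y := by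
    conv_lhs => rw [← hmn, Tw_add]
    refine Tw_le_const h.nonneg _ (fun x y => ?_) x y
    exact (Tw_le_Uw h.nonneg m (fun _ _ => ind_nonneg _) x y).trans (hconc m hm1 B hBpos.le 0 x y)
  have d3 := IH (n - m) (by omega) (by omega) x y
  have d4 := hsup n x y
  have hm4 : √(n : ℝ) / 2 ≤ √(m : ℝ) := by
    have : (n : ℝ) ≤ 4 * m := by exact_mod_cast (by omega : n ≤ 4 * m)
    apply le_sqrt_of_sq_le
    rw [div_pow, sq_sqrt hnR.le]; linarith
  have hnm : √(n : ℝ) / 2 ≤ √((n - m : ℕ) : ℝ) := by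
    have : (n : ℝ) ≤ 4 * (n - m : ℕ) := by exact_mod_cast (by omega : n ≤ 4 * (n - m))
    apply le_sqrt_of_sq_le
    rw [div_pow, sq_sqrt hnR.le]; linarith
  set Y := 1 + max y 0 with hYdef
  have d5 : (Tw Q g ^ (n - m)) (fun _ _ => 1) x y ≤ 2 * K * Y / √n := by
    refine d3.trans ?_
    calc K * Y / √((n - m : ℕ) : ℝ) ≤ K * Y / (√(n : ℝ) / 2) := by gcongr
      _ = _ := by field_simp
  have d6 : C * (1 + B) / √m ≤ 1 / 4 := by
    calc C * (1 + B) / √m ≤ C * (1 + B) / (√(n : ℝ) / 2) := by gcongr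
      _ ≤ 1 / 4 := by
        rw [div_le_iff₀ (by positivity)]
        have : C * B = √n / 16 := by rw [hB, hε]; field_simp
        nlinarith
  have d7 : 1 / B * (Tw Q g ^ n) (fun x y => y + q x) x y ≤ K * Y / 2 / √n := by
    calc 1 / B * (Tw Q g ^ n) (fun x y => y + q x) x y ≤ 1 / B * ((1 + A) * Y) := by
          gcongr
          nlinarith
      _ = (2 * (1 + A) / ε) * Y / 2 / √n := by rw [hB]; field_simp
      _ ≤ _ := by gcongr
  have d8 : C * (1 + B) / √m * (Tw Q g ^ (n - m)) (fun _ _ => 1) x y ≤ 1 / 4 * (2 * K * Y / √n) :=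
    mul_le_mul d6 d5 (Tw_nonneg h.nonneg _ (fun _ _ => zero_le_one) _ _) (by norm_num)
  calc _ ≤ _ := d1
    _ ≤ K * Y / 2 / √n + 1 / 4 * (2 * K * Y / √n) := add_le_add d7 (d2.trans d8)
    _ = K * Y / √n := by ring

/-! ## Time reversal and the three-piece decomposition -/

/-- Indicator of `{w} × [u, u + a]`. -/
noncomputable def Ebox (a : ℝ) (w : X) (u : ℝ) : X → ℝ → ℝ := fun x y =>
  ind (x = w) * ind (y ∈ Set.Icc u (u + a))

theorem Tw_Ebox [Fintype X] {Q g : X → X → ℝ} (hQ : ∀ x x', 0 ≤ Q x x')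
    (a : ℝ) (w : X) (u : ℝ) (x : X) (y : ℝ) :
    Tw Q g (Ebox a w u) x y ≤
      (ind (0 < u + a) • ∑ v, Q v w • Ebox a v (u - g v w)) x y := by
  rw [Tw_apply]
  simp only [Pi.smul_apply, Finset.sum_apply, smul_eq_mul, Ebox]
  rw [Finset.sum_eq_single w, Finset.sum_eq_single x]
  · rw [ind_true rfl, ind_true rfl, one_mul, one_mul, mul_left_comm (ind (0 < u + a))]
    refine mul_le_mul_of_nonneg_left ?_ (hQ _ _)
    by_cases h1 : 0 < y + g x w ∧ y + g x w ∈ Set.Icc u (u + a)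
    · obtain ⟨h1, h2, h3⟩ := h1
      rw [ind_true h1, ind_true (p := y + g x w ∈ Set.Icc u (u + a)) ⟨h2, h3⟩,
        ind_true (by linarith : 0 < u + a),
        ind_true (p := y ∈ Set.Icc (u - g x w) (u - g x w + a)) ⟨by linarith, by linarith⟩]
    · have : ind (0 < y + g x w) * ind (y + g x w ∈ Set.Icc u (u + a)) = 0 := by
        by_cases h2 : 0 < y + g x w
        · rw [ind_false (fun h3 => h1 ⟨h2, h3⟩), mul_zero]
        · rw [ind_false h2, zero_mul]
      rw [this]
      exact mul_nonneg (ind_nonneg _) (ind_nonneg _)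
  · intro v _ hv
    rw [ind_false (fun h => hv h.symm)]; ring
  · simp
  · intro v _ hv
    rw [ind_false hv]; ring
  · simp

theorem Good.reversal [Fintype X] {Q g : X → X → ℝ} {ν : X → ℝ} (h : Good Q g ν)
    (lam : (X → ℝ → ℝ) →ₗ[ℝ] ℝ) (mono : ∀ G H, (∀ x y, G x y ≤ H x y) → lam G ≤ lam H)
    {κ a : ℝ} (hκ : ∀ w u, lam (Ebox a w u) ≤ κ * ν w) (k : ℕ) : ∀ w u,
      lam ((Tw Q g ^ (k + 1)) (Ebox a w u)) ≤ κ * ν w * (ind (0 < u + a) *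
        (Tw (dualK Q ν) (fun x x' => - g x' x) ^ k) (fun _ _ => 1) w (u + a)) := by
  have step : ∀ k w u, lam ((Tw Q g ^ (k + 1)) (Ebox a w u)) ≤
      ind (0 < u + a) * ∑ v, Q v w * lam ((Tw Q g ^ k) (Ebox a v (u - g v w))) := by
    intro k w u
    rw [Tw_succ']
    refine (mono _ _ (Tw_mono h.nonneg k (Tw_Ebox h.nonneg a w u))).trans (le_of_eq ?_)
    simp only [map_smul, map_sum, smul_eq_mul]
  have hd : ∀ v w, Q v w * ν v = ν w * dualK Q ν w v := fun v w => by
    have := (h.nuPos w).ne'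
    simp only [dualK]; field_simp
  induction k with
  | zero =>
    intro w u
    refine (step 0 w u).trans ?_
    simp only [pow_zero, Module.End.one_apply]
    rw [mul_one, mul_comm (κ * ν w)]
    refine mul_le_mul_of_nonneg_left ?_ (ind_nonneg _)
    calc ∑ v, Q v w * lam (Ebox a v (u - g v w)) ≤ ∑ v, Q v w * (κ * ν v) :=
          Finset.sum_le_sum fun v _ => mul_le_mul_of_nonneg_left (hκ _ _) (h.nonneg _ _)
      _ = κ * ν w := by
          rw [← h.nuInv w, Finset.mul_sum]
          exact Finset.sum_congr rfl fun v _ => by ring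
  | succ k ih =>
    intro w u
    refine (step (k + 1) w u).trans ?_
    rw [mul_left_comm (κ * ν w)]
    refine mul_le_mul_of_nonneg_left ?_ (ind_nonneg _)
    rw [Tw_succ, Tw_apply, Finset.mul_sum]
    refine Finset.sum_le_sum fun v _ => ?_
    refine (mul_le_mul_of_nonneg_left (ih v _) (h.nonneg _ _)).trans (le_of_eq ?_)
    have e : u - g v w + a = u + a + -g v w := by ring
    rw [e]
    generalize (Tw (dualK Q ν) (fun x x' => - g x' x) ^ k) (fun _ _ => 1) v (u + a + -g v w) = R
    linear_combination κ * ind (0 < u + a + -g v w) * R * hd v w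

theorem Good.final [Fintype X] [DecidableEq X] [Nonempty X] {Q g : X → X → ℝ} {ν : X → ℝ}
    (h : Good Q g ν) : ∃ c > 0, ∀ a : ℝ, 0 < a → ∀ z : ℝ, 0 ≤ z → ∀ n : ℕ, 1 ≤ n → ∀ x y,
      (Tw Q g ^ n) (fun _ y => ind (y ∈ Set.Icc z (z + a))) x y ≤
        c / (n * √n) * (1 + a) ^ 2 * (1 + z) * (1 + max y 0) := by
  obtain ⟨C, hC, hconc⟩ := h.conc
  obtain ⟨K, hK, hsurv⟩ := h.survival
  obtain ⟨K', hK', hsurv'⟩ := h.dual.survival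
  set V := ∑ x, 1 / ν x with hV
  set W := ∑ x, ν x with hW
  have hVpos : 0 < V := Finset.sum_pos (fun x _ => one_div_pos.2 (h.nuPos x)) Finset.univ_nonempty
  have hWpos : 0 < W := Finset.sum_pos (fun x _ => h.nuPos x) Finset.univ_nonempty
  have hVν : ∀ w, 1 ≤ V * ν w := by
    intro w
    have := Finset.single_le_sum (f := fun x => 1 / ν x)
      (fun x _ => (one_div_pos.2 (h.nuPos x)).le) (Finset.mem_univ w)
    have h2 := mul_le_mul_of_nonneg_right this (h.nuPos w).le
    rwa [one_div_mul_cancel (h.nuPos w).ne'] at h2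
  refine ⟨27 * K * K' * C * V * W + 36, by positivity, fun a ha z hz n hn x y => ?_⟩
  have hnR : (0 : ℝ) < n := by exact_mod_cast hn
  have hsn : 0 < √(n : ℝ) := sqrt_pos.2 hnR
  have hsq : √(n : ℝ) * √(n : ℝ) = n := mul_self_sqrt hnR.le
  set Y := 1 + max y 0 with hYdef
  have hY : 1 ≤ Y := by linarith [le_max_right y 0]
  by_cases hsmall : n < 6
  · have h1 := Tw_mono (g := g) h.nonneg n (G := fun _ y => ind (y ∈ Set.Icc z (z + a)))
      (H := fun _ _ => 1) (fun _ _ => ind_le_one _) x y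
    refine (h1.trans (Tw_one_le h.nonneg h.rowSum n x y)).trans ?_
    have hn6 : (n : ℝ) ≤ 6 := by exact_mod_cast hsmall.le
    have hs6 : √(n : ℝ) ≤ 6 := by
      rw [sqrt_le_left (by norm_num)]; linarith
    have h2 : 1 ≤ (27 * K * K' * C * V * W + 36) / (n * √n) := by
      rw [one_le_div (by positivity)]
      have : 0 < 27 * K * K' * C * V * W := by positivity
      nlinarith
    have h3 : 1 ≤ (1 + a) ^ 2 := by nlinarith
    calc (1 : ℝ) = 1 * 1 * 1 * 1 := by ring
      _ ≤ _ := by gcongr; linarith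
  set m := n / 3 with hm
  obtain ⟨k, hk⟩ : ∃ k, m = k + 1 := ⟨m - 1, by omega⟩
  have hk1 : 1 ≤ k := by omega
  have split : n = (n - 2 * m) + (m + (k + 1)) := by omega
  have root : ∀ j : ℕ, n ≤ 9 * j → √(n : ℝ) / 3 ≤ √(j : ℝ) := by
    intro j hj
    have : (n : ℝ) ≤ 9 * j := by exact_mod_cast hj
    apply le_sqrt_of_sq_le
    rw [div_pow, sq_sqrt hnR.le]; linarith
  have rm := root m (by omega)
  have rk := root k (by omega)
  have r1 := root (n - 2 * m) (by omega)
  set κ := 3 * C * (1 + a) * V / √n with hκdef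
  have hκpos : 0 < κ := by positivity
  -- the middle and last pieces
  have mid : ∀ x y, (Tw Q g ^ (m + (k + 1))) (fun _ y => ind (y ∈ Set.Icc z (z + a))) x y ≤
      κ * W * (3 * K' * ((1 + a) * (1 + z)) / √n) := by
    intro x y
    rw [Tw_add]
    refine (Tw_le_Uw h.nonneg m (Tw_nonneg h.nonneg _ (fun _ _ => ind_nonneg _)) x y).trans ?_
    have hsum : (fun (_ : X) (y : ℝ) => ind (y ∈ Set.Icc z (z + a))) = ∑ w, Ebox a w z := by
      funext x y
      simp only [Finset.sum_apply, Ebox]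
      rw [Finset.sum_eq_single x]
      · rw [ind_true rfl, one_mul]
      · intro v _ hv
        rw [ind_false (fun h => hv h.symm), zero_mul]
      · simp
    let lam : (X → ℝ → ℝ) →ₗ[ℝ] ℝ :=
      (LinearMap.proj y : (ℝ → ℝ) →ₗ[ℝ] ℝ) ∘ₗ
        (LinearMap.proj x : (X → ℝ → ℝ) →ₗ[ℝ] (ℝ → ℝ)) ∘ₗ (Uw Q g ^ m)
    have hlam : ∀ G, lam G = (Uw Q g ^ m) G x y := fun G => rfl
    have mono : ∀ G H, (∀ x y, G x y ≤ H x y) → lam G ≤ lam H := fun G H hGH => by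
      rw [hlam, hlam]; exact Uw_mono h.nonneg m hGH x y
    have hκ : ∀ w u, lam (Ebox a w u) ≤ κ * ν w := by
      intro w u
      have h1 : lam (Ebox a w u) ≤ C * (1 + a) / √m := by
        rw [hlam]
        refine le_trans (Uw_mono h.nonneg m (fun x y => ?_) x y)
          (hconc m (by omega) a ha.le u x y)
        exact mul_le_of_le_one_left (ind_nonneg _) (ind_le_one _)
      refine h1.trans ?_
      calc C * (1 + a) / √m ≤ C * (1 + a) / (√(n : ℝ) / 3) := by gcongr
        _ = (3 * C * (1 + a) / √n) * 1 := by field_simp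
        _ ≤ (3 * C * (1 + a) / √n) * (V * ν w) := by gcongr; exact hVν w
        _ = κ * ν w := by rw [hκdef]; ring
    rw [hsum, map_sum, ← hlam, map_sum, mul_assoc, hW, Finset.sum_mul, Finset.mul_sum]
    refine Finset.sum_le_sum fun w _ => ?_
    refine (h.reversal lam mono hκ k w z).trans ?_
    rw [← mul_assoc κ]
    refine mul_le_mul_of_nonneg_left ?_ (mul_nonneg hκpos.le (h.nuPos w).le)
    have hs := hsurv' k hk1 w (z + a)
    rw [max_eq_left (by linarith)] at hs
    refine (mul_le_of_le_one_left (Tw_nonneg h.dual.nonneg _ (fun _ _ => zero_le_one) _ _)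
      (ind_le_one _)).trans (hs.trans ?_)
    have h5 : 1 + (z + a) ≤ (1 + a) * (1 + z) := by nlinarith
    calc K' * (1 + (z + a)) / √k ≤ K' * ((1 + a) * (1 + z)) / (√(n : ℝ) / 3) := by gcongr
      _ = _ := by field_simp
  have first := Tw_le_const (g := g) h.nonneg (n - 2 * m) mid x y
  rw [← Tw_add, ← split] at first
  refine first.trans ?_
  have hs := hsurv (n - 2 * m) (by omega) x y
  have hs2 : (Tw Q g ^ (n - 2 * m)) (fun _ _ => 1) x y ≤ 3 * K * Y / √n := by
    refine hs.trans ?_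
    calc K * Y / √((n - 2 * m : ℕ) : ℝ) ≤ K * Y / (√(n : ℝ) / 3) := by gcongr
      _ = _ := by field_simp
  calc _ ≤ κ * W * (3 * K' * ((1 + a) * (1 + z)) / √n) * (3 * K * Y / √n) := by gcongr
    _ = 27 * K * K' * C * V * W / (√n * √n * √n) * (1 + a) ^ 2 * (1 + z) * Y := by
        rw [hκdef]; field_simp; ring
    _ ≤ _ := by
        rw [hsq]
        gcongr
        linarith

/-! ## Identification with the path expectation -/

theorem pathExt_cons_succ (x x' : X) {n : ℕ} (p : Fin n → X) {k : ℕ} (hk : k ≤ n) :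
    pathExt x (Fin.cons x' p : Fin (n + 1) → X) (k + 1) = pathExt x' p k := by
  unfold pathExt
  rw [dif_pos ⟨by omega, by omega⟩]
  rcases Nat.eq_zero_or_pos k with h0 | h0
  · subst h0
    rw [dif_neg (by omega)]
    rfl
  · rw [dif_pos ⟨h0, hk⟩]
    have : (⟨k + 1 - 1, by omega⟩ : Fin (n + 1)) = Fin.succ ⟨k - 1, by omega⟩ := by
      ext; simp; omega
    rw [this, Fin.cons_succ]

theorem Spath_cons_succ (f : X → ℝ) (x x' : X) {n : ℕ} (p : Fin n → X) {k : ℕ} (hk : k ≤ n) :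
    Spath f (pathExt x (Fin.cons x' p : Fin (n + 1) → X)) (k + 1) =
      f x' + Spath f (pathExt x' p) k := by
  induction k with
  | zero =>
    simp only [Spath, zero_add, Finset.Icc_self, Finset.sum_singleton]
    have := pathExt_cons_succ x x' p hk
    rw [zero_add] at this
    rw [this]
    simp [pathExt]
  | succ k ih =>
    have e1 : ∀ ω : ℕ → X, ∀ j : ℕ, Spath f ω (j + 1) = Spath f ω j + f (ω (j + 1)) := by
      intro ω j
      unfold Spath
      rw [Finset.sum_Icc_succ_top (by omega)]
    rw [e1 _ (k + 1), ih (by omega), e1 _ k, pathExt_cons_succ x x' p hk, add_assoc]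

theorem survives_cons (f : X → ℝ) (x x' : X) {n : ℕ} (p : Fin n → X) (y : ℝ) :
    survives f y (n + 1) (pathExt x (Fin.cons x' p : Fin (n + 1) → X)) ↔
      0 < y + f x' ∧ survives f (y + f x') n (pathExt x' p) := by
  unfold survives
  constructor
  · intro H
    refine ⟨?_, fun k hk => ?_⟩
    · have := H 1 (by simp)
      have e := Spath_cons_succ f x x' p (Nat.zero_le n)
      rw [zero_add] at e
      rw [e] at this
      simpa [Spath] using this
    · rw [Finset.mem_Icc] at hk
      have := H (k + 1) (by rw [Finset.mem_Icc]; omega)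
      rw [Spath_cons_succ f x x' p hk.2] at this
      linarith
  · rintro ⟨H0, H⟩ k hk
    rw [Finset.mem_Icc] at hk
    obtain ⟨j, rfl⟩ : ∃ j, k = j + 1 := ⟨k - 1, by omega⟩
    rw [Spath_cons_succ f x x' p (by omega)]
    rcases Nat.eq_zero_or_pos j with h0 | h0
    · subst h0; simpa [Spath] using H0
    · have := H j (by rw [Finset.mem_Icc]; omega)
      linarith

theorem ind_and (p q : Prop) : ind (p ∧ q) = ind p * ind q := by
  by_cases hp : p <;> by_cases hq : q <;> simp [ind, hp, hq]

theorem Ex_eq_Tw [Fintype X] (P : X → X → ℝ) (f ψ : X → ℝ) (I : Set ℝ) (n : ℕ) :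
    ∀ x y, Ex P x n (fun ω => ψ (ω n) * ind (y + Spath f ω n ∈ I ∧ survives f y n ω)) =
      (Tw P (fun _ x' => f x') ^ n) (fun x y => ψ x * ind (y ∈ I)) x y := by
  induction n with
  | zero =>
    intro x y
    have hs : ∀ ω : ℕ → X, survives f y 0 ω := by intro ω k hk; simp at hk
    simp [Ex, wt, pathExt, Spath, hs]
  | succ n ih =>
    intro x y
    rw [Tw_succ, Tw_apply]
    simp only [← ih]
    unfold Ex
    rw [← (Fin.consEquiv (fun _ : Fin (n + 1) => X)).sum_comp, Fintype.sum_prod_type]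
    refine Finset.sum_congr rfl fun x' _ => ?_
    rw [Finset.mul_sum, Finset.mul_sum]
    refine Finset.sum_congr rfl fun p _ => ?_
    have e0 : (Fin.consEquiv (fun _ : Fin (n + 1) => X)) (x', p) =
      (Fin.cons x' p : Fin (n + 1) → X) := rfl
    rw [e0, List.ofFn_cons]
    beta_reduce
    rw [pathExt_cons_succ x x' p le_rfl, Spath_cons_succ f x x' p le_rfl]
    simp only [survives_cons, ind_and, wt, add_assoc]
    ring

/-- Theorem 2.5, part 2: uniform bound of order `n^{-3/2}`. -/
theorem conditioned_local_limit_bound [Fintype X] [DecidableEq X] [Nonempty X]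
    (P : X → X → ℝ) (ν f : X → ℝ) (hS : IsStochastic P ν)
    (h1 : Primitive P) (h2 : ∑ x, f x * ν x = 0) (h3 : NonLattice P f) :
    ∃ c > 0, ∀ a : ℝ, 0 < a → ∀ ψ : X → ℝ, (∀ b, 0 ≤ ψ b) →
      ∀ y z : ℝ, 0 ≤ z → ∀ n : ℕ, 1 ≤ n → ∀ x : X,
        Ex P x n (fun ω =>
            ψ (ω n) * ind (y + Spath f ω n ∈ Set.Icc z (z + a) ∧ survives f y n ω)) ≤
          c * supN ψ / (n : ℝ) ^ (3 / 2 : ℝ) * (1 + a ^ 3) * (1 + z) * (1 + max y 0) := by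
  have hG := good_of_hyp P ν f hS h1 h2 h3
  obtain ⟨c, hc, hb⟩ := hG.final
  refine ⟨4 * c, by positivity, fun a ha ψ hψ y z hz n hn x => ?_⟩
  rw [Ex_eq_Tw P f ψ (Set.Icc z (z + a)) n x y]
  have hsup : ∀ w, ψ w ≤ supN ψ := fun w =>
    (le_abs_self _).trans (le_ciSup (f := fun w => |ψ w|) (Set.finite_range _).bddAbove w)
  have hsup0 : 0 ≤ supN ψ := (hψ x).trans (hsup x)
  have d := Tw_mono (g := fun _ x' => f x') hS.nonneg n
    (G := fun x y => ψ x * ind (y ∈ Set.Icc z (z + a)))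
    (H := supN ψ • (fun _ y => ind (y ∈ Set.Icc z (z + a))))
    (fun x y => mul_le_mul_of_nonneg_right (hsup x) (ind_nonneg _)) x y
  refine d.trans ?_
  rw [map_smul, Pi.smul_apply, Pi.smul_apply, smul_eq_mul]
  have hnR : (0 : ℝ) < n := by exact_mod_cast hn
  have e : (n : ℝ) ^ (3 / 2 : ℝ) = n * √n := by
    rw [sqrt_eq_rpow, show (3 / 2 : ℝ) = 1 + 1 / 2 by norm_num, rpow_add hnR, rpow_one]
  rw [e]
  have hm := le_max_right y 0
  have ha3 : (1 + a) ^ 2 ≤ 4 * (1 + a ^ 3) := by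
    nlinarith [mul_nonneg ha.le (sq_nonneg (a - 1)), sq_nonneg (a - 1)]
  calc supN ψ * _ ≤ supN ψ * (c / (n * √n) * (1 + a) ^ 2 * (1 + z) * (1 + max y 0)) :=
        mul_le_mul_of_nonneg_left (hb a ha z hz n hn x y) hsup0
    _ ≤ supN ψ * (c / (n * √n) * (4 * (1 + a ^ 3)) * (1 + z) * (1 + max y 0)) := by
        gcongr
    _ = _ := by ring
end CLLT
end

section
/- Let σ > 0. There exists a constant c > 0 (depending only on σ) such that for every ε > 0 and every h ∈ 𝓗_ε for which h̄_{2ε} and ẖ_{2ε} are also measurable and integrable, and for every y ∈ ℝ and n ≥ 1: (1) √n·((h̄_ε * κ_{ε²}) * φ_{σ√n})(y) ≤ √n·(h * φ_{σ√n})(y) + c·‖h̄_{2ε} − h‖_{L¹} + c·ε·‖h‖_{L¹}; (2) √n·((h̄_ε * κ_{ε²}) * φ_{σ√n})(y) ≤ c·‖h̄_ε‖_{L¹}; (3) √n·((ẖ_ε * κ_{ε²}) * φ_{σ√n})(y) ≥ √n·(h * φ_{σ√n})(y) − c·‖h − ẖ_{2ε}‖_{L¹} − c·ε·‖h‖_{L¹}.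 -/
open Finset Filter Real Topology MeasureTheory

namespace CLLT

variable {X : Type*}

lemma kapp_nonneg (u : ℝ) : 0 ≤ kapp u := by
  unfold kapp; split_ifs <;> positivity

lemma kapp_meas : Measurable kapp := by
  unfold kapp
  refine Measurable.ite (measurableSet_singleton 0) measurable_const ?_
  fun_prop

lemma kapp_le_const (u : ℝ) : kapp u ≤ 1 / (2 * π) := by
  unfold kapp
  split_ifs with h
  · exact le_rfl
  · have h2 : u / 2 ≠ 0 := by positivity
    gcongr
    rw [div_pow, div_le_one (by positivity)]
    exact sq_le_sq.mpr Real.abs_sin_le_abs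

lemma kapp_le_tail (u : ℝ) : kapp u * u ^ 2 ≤ 2 / π := by
  unfold kapp
  split_ifs with h
  · simp [h]; positivity
  · have : (Real.sin (u / 2) / (u / 2)) ^ 2 / (2 * π) * u ^ 2 = Real.sin (u / 2) ^ 2 * (2 / π) := by
      field_simp
    rw [this]
    have := Real.sin_sq_le_one (u / 2)
    have : 0 ≤ 2 / π := by positivity
    nlinarith

lemma kapp_integrable : Integrable kapp := by
  refine (integrable_inv_one_add_sq.const_mul (5 / (2 * π))).mono' kapp_meas.aestronglyMeasurable ?_
  refine Filter.Eventually.of_forall fun u => ?_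
  rw [Real.norm_of_nonneg (kapp_nonneg u), ← div_eq_mul_inv, le_div_iff₀ (by positivity)]
  have h1 := kapp_le_const u
  have h2 := kapp_le_tail u
  have : 5 / (2 * π) = 1 / (2 * π) + 2 / π := by field_simp; norm_num
  rw [this]; nlinarith

noncomputable def tri (x : ℝ) : ℂ := ((max (1 - |x|) 0 : ℝ) : ℂ)

lemma tri_cont : Continuous tri := by
  unfold tri; fun_prop

lemma tri_zero (x : ℝ) (hx : x ∉ Set.Ioc (-1 : ℝ) 1) : tri x = 0 := by
  unfold tri
  have : 1 - |x| ≤ 0 := by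
    rw [Set.mem_Ioc, not_and_or] at hx
    rcases hx with h | h
    · have := neg_le_abs x; linarith
    · have := le_abs_self x; linarith
  simp [max_eq_right this]

lemma tri_integrable : Integrable tri := by
  refine tri_cont.integrable_of_hasCompactSupport ?_
  refine HasCompactSupport.intro (isCompact_Icc (a := (-1 : ℝ)) (b := 1)) fun x hx => ?_
  exact tri_zero x fun h => hx ⟨h.1.le, h.2⟩

lemma tri_exp_integral (b : ℂ) (hb : b ≠ 0) :
    ∫ x : ℝ, Complex.exp (b * x) * tri x = (Complex.exp b + Complex.exp (-b) - 2) / b ^ 2 := by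
  have h0 : ∫ x : ℝ, Complex.exp (b * x) * tri x = ∫ x in (-1 : ℝ)..1, Complex.exp (b * x) * tri x := by
    rw [intervalIntegral.integral_of_le (by norm_num)]
    rw [setIntegral_eq_integral_of_forall_compl_eq_zero]
    intro x hx
    rw [tri_zero x hx, mul_zero]
  have hc : Continuous fun x : ℝ => Complex.exp (b * x) * tri x := by
    have := tri_cont
    fun_prop
  rw [h0, ← intervalIntegral.integral_add_adjacent_intervals (b := 0)
    (hc.intervalIntegrable _ _) (hc.intervalIntegrable _ _)]
  have hexp : ∀ x : ℝ, HasDerivAt (fun x : ℝ => Complex.exp (b * x)) (Complex.exp (b * x) * b) x := by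
    intro x
    have := ((Complex.ofRealCLM.hasDerivAt (x := x)).const_mul b).cexp
    simpa using this
  have hid : ∀ x : ℝ, HasDerivAt (fun x : ℝ => (x : ℂ)) 1 x := by
    intro x
    simpa using (hasDerivAt_id x).ofReal_comp
  have e1 : ∫ x in (-1 : ℝ)..0, Complex.exp (b * x) * tri x =
      1 / b - 1 / b ^ 2 + Complex.exp (-b) / b ^ 2 := by
    rw [intervalIntegral.integral_eq_sub_of_hasDerivAt
      (f := fun x : ℝ => (1 + (x : ℂ)) * Complex.exp (b * x) / b - Complex.exp (b * x) / b ^ 2)]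
    · simp
    · intro x hx
      rw [Set.uIcc_of_le (by norm_num)] at hx
      have ht : tri x = 1 + x := by
        unfold tri
        rw [abs_of_nonpos hx.2, max_eq_left (by linarith [hx.1])]
        push_cast; ring
      rw [ht]
      refine HasDerivAt.congr_deriv (((((hid x).const_add 1).mul (hexp x)).div_const b).sub
        ((hexp x).div_const (b ^ 2))) ?_
      field_simp
      ring
    · exact hc.intervalIntegrable _ _
  have e2 : ∫ x in (0 : ℝ)..1, Complex.exp (b * x) * tri x =
      Complex.exp b / b ^ 2 - 1 / b - 1 / b ^ 2 := by
    rw [intervalIntegral.integral_eq_sub_of_hasDerivAt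
      (f := fun x : ℝ => (1 - (x : ℂ)) * Complex.exp (b * x) / b + Complex.exp (b * x) / b ^ 2)]
    · simp
      ring
    · intro x hx
      rw [Set.uIcc_of_le (by norm_num)] at hx
      have ht : tri x = 1 - x := by
        unfold tri
        rw [abs_of_nonneg hx.1, max_eq_left (by linarith [hx.2])]
        push_cast; ring
      rw [ht]
      refine HasDerivAt.congr_deriv (((((hid x).const_sub 1).mul (hexp x)).div_const b).add
        ((hexp x).div_const (b ^ 2))) ?_
      field_simp
      ring
    · exact hc.intervalIntegrable _ _
  rw [e1, e2]
  ring

open FourierTransform in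
lemma tri_fourier (w : ℝ) (hw : w ≠ 0) : 𝓕 tri w = ((2 * π * kapp (2 * π * w) : ℝ) : ℂ) := by
  rw [Real.fourier_real_eq_integral_exp_smul]
  have hb : (-2 * π * w * Complex.I : ℂ) ≠ 0 := by
    have : (π : ℂ) ≠ 0 := by exact_mod_cast Real.pi_ne_zero
    have : (w : ℂ) ≠ 0 := by exact_mod_cast hw
    simp_all
  have h1 := tri_exp_integral _ hb
  have h2 : ∀ x : ℝ, Complex.exp (((-2 * π * x * w : ℝ) : ℂ) * Complex.I) • tri x =
      Complex.exp ((-2 * π * w * Complex.I : ℂ) * x) * tri x := by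
    intro x
    rw [smul_eq_mul]
    congr 2
    push_cast; ring
  simp_rw [h2]
  rw [h1]
  have h3 : Complex.exp (-2 * π * w * Complex.I) + Complex.exp (-(-2 * π * w * Complex.I))
      = 2 * Complex.cos (2 * (π * w)) := by
    rw [Complex.two_cos, add_comm]
    congr 2 <;> ring
  have hk : 2 * π * kapp (2 * π * w) = Real.sin (π * w) ^ 2 / (π * w) ^ 2 := by
    unfold kapp
    rw [if_neg (by positivity)]
    have : 2 * π * w / 2 = π * w := by ring
    rw [this, div_pow]
    field_simp
  rw [h3, hk, Complex.cos_two_mul]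
  have hs := Complex.sin_sq_add_cos_sq (π * w)
  push_cast
  have hpi : (π : ℂ) ≠ 0 := by exact_mod_cast Real.pi_ne_zero
  have hw' : (w : ℂ) ≠ 0 := by exact_mod_cast hw
  have : (-2 * π * w * Complex.I : ℂ) ^ 2 = -4 * (π * w) ^ 2 := by
    ring_nf; rw [Complex.I_sq]; ring
  rw [this, div_eq_div_iff (by simp_all) (by simp_all)]
  linear_combination 4 * (π * w) ^ 2 * hs

open FourierTransform in
lemma kapp_integral : ∫ u, kapp u = 1 := by
  have hae : (fun w : ℝ => ((2 * π * kapp (2 * π * w) : ℝ) : ℂ)) =ᵐ[volume] 𝓕 tri := by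
    have : ∀ᵐ w : ℝ, w ≠ 0 := by
      simp [ae_iff]
    filter_upwards [this] with w hw
    exact (tri_fourier w hw).symm
  have hi : Integrable (𝓕 tri) := by
    refine Integrable.congr ?_ hae
    refine Integrable.ofReal ?_
    exact ((kapp_integrable.comp_mul_left' (by positivity : (2 * π) ≠ 0))).const_mul _
  have h := tri_integrable.fourierInv_fourier_eq hi (v := 0) tri_cont.continuousAt
  rw [Real.fourierInv_eq'] at h
  simp only [inner_zero_right, mul_zero, Complex.ofReal_zero, zero_mul, Complex.exp_zero, one_smul] at h
  rw [← integral_congr_ae hae, integral_complex_ofReal, integral_const_mul] at h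
  rw [Measure.integral_comp_mul_left kapp (2 * π)] at h
  have h3 : |(2 * π)⁻¹| = (2 * π)⁻¹ := abs_of_pos (by positivity)
  rw [h3, smul_eq_mul, ← mul_assoc, mul_inv_cancel₀ (by positivity), one_mul] at h
  have : tri 0 = 1 := by simp [tri]
  rw [this] at h
  exact_mod_cast h

lemma kappD_nonneg {δ : ℝ} (hδ : 0 < δ) (u : ℝ) : 0 ≤ kappD δ u :=
  div_nonneg (kapp_nonneg _) hδ.le

lemma kappD_meas (δ : ℝ) : Measurable (kappD δ) := by
  unfold kappD
  exact (kapp_meas.comp (measurable_id.div_const δ)).div_const δ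

lemma kappD_le {δ : ℝ} (hδ : 0 < δ) (u : ℝ) : kappD δ u ≤ 1 / (2 * π) / δ := by
  unfold kappD
  gcongr
  exact kapp_le_const _

lemma kappD_integrable {δ : ℝ} (hδ : 0 < δ) : Integrable (kappD δ) :=
  (kapp_integrable.comp_div hδ.ne').div_const δ

lemma kappD_integral {δ : ℝ} (hδ : 0 < δ) : ∫ u, kappD δ u = 1 := by
  unfold kappD
  rw [integral_div, Measure.integral_comp_div, kapp_integral, abs_of_pos hδ]
  simp [hδ.ne']

noncomputable def kTail (ε : ℝ) : ℝ → ℝ :=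
  Set.indicator {v : ℝ | ε < |v|} (kappD (ε ^ 2))

noncomputable def kMid (ε : ℝ) : ℝ → ℝ :=
  Set.indicator {v : ℝ | ε < |v|}ᶜ (kappD (ε ^ 2))

lemma tailSet_meas (ε : ℝ) : MeasurableSet {v : ℝ | ε < |v|} :=
  measurableSet_lt measurable_const (by fun_prop)

lemma kMid_add_kTail (ε v : ℝ) : kMid ε v + kTail ε v = kappD (ε ^ 2) v := by
  unfold kMid kTail
  by_cases h : v ∈ {v : ℝ | ε < |v|}
  · simp only [Set.mem_ofPred_eq] at h
    simp [Set.indicator, h]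
  · simp only [Set.mem_ofPred_eq] at h
    simp [Set.indicator, h]

lemma kTail_nonneg {ε : ℝ} (hε : 0 < ε) (v : ℝ) : 0 ≤ kTail ε v :=
  Set.indicator_nonneg (fun _ _ => kappD_nonneg (by positivity) _) v

lemma kMid_nonneg {ε : ℝ} (hε : 0 < ε) (v : ℝ) : 0 ≤ kMid ε v :=
  Set.indicator_nonneg (fun _ _ => kappD_nonneg (by positivity) _) v

lemma kTail_integrable {ε : ℝ} (hε : 0 < ε) : Integrable (kTail ε) :=
  (kappD_integrable (by positivity)).indicator (tailSet_meas ε)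

lemma kMid_integrable {ε : ℝ} (hε : 0 < ε) : Integrable (kMid ε) :=
  (kappD_integrable (by positivity)).indicator (tailSet_meas ε).compl

lemma kTail_integral_nonneg {ε : ℝ} (hε : 0 < ε) : 0 ≤ ∫ v, kTail ε v :=
  integral_nonneg (kTail_nonneg hε)

lemma kMid_integral {ε : ℝ} (hε : 0 < ε) : ∫ v, kMid ε v = 1 - ∫ v, kTail ε v := by
  rw [eq_sub_iff_add_eq, ← integral_add (kMid_integrable hε) (kTail_integrable hε)]
  simp_rw [kMid_add_kTail]
  exact kappD_integral (by positivity)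

lemma kTail_integral_le_one {ε : ℝ} (hε : 0 < ε) : ∫ v, kTail ε v ≤ 1 := by
  have h1 := kMid_integral hε
  have h2 : 0 ≤ ∫ v, kMid ε v := integral_nonneg (kMid_nonneg hε)
  linarith

lemma kTail_integral_le {ε : ℝ} (hε : 0 < ε) : ∫ v, kTail ε v ≤ 4 * ε := by
  have hI : Integrable fun v : ℝ => 4 / π * (1 + (v / ε) ^ 2)⁻¹ :=
    (integrable_inv_one_add_sq.comp_div hε.ne').const_mul _
  have hE : ∫ v : ℝ, 4 / π * (1 + (v / ε) ^ 2)⁻¹ = 4 * ε := by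
    rw [integral_const_mul, Measure.integral_comp_div (fun v : ℝ => (1 + v ^ 2)⁻¹),
      integral_univ_inv_one_add_sq, abs_of_pos hε, smul_eq_mul]
    field_simp
  rw [← hE]
  refine integral_mono (kTail_integrable hε) hI fun v => ?_
  dsimp only
  unfold kTail
  by_cases h : v ∈ {v : ℝ | ε < |v|}
  · rw [Set.indicator_of_mem h]
    simp only [Set.mem_ofPred_eq] at h
    rw [← div_eq_mul_inv, le_div_iff₀ (by positivity)]
    have hv : 1 ≤ (v / ε) ^ 2 := by
      rw [div_pow, one_le_div (by positivity), ← sq_abs v]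
      gcongr
    have h0 := kappD_nonneg (show 0 < ε ^ 2 by positivity) v
    have h1 : kappD (ε ^ 2) v * (v / ε) ^ 2 ≤ 2 / π := by
      have := kapp_le_tail (v / ε ^ 2)
      refine le_trans (le_of_eq ?_) this
      unfold kappD
      field_simp
    have : 4 / π = 2 * (2 / π) := by ring
    rw [this]
    nlinarith
  · rw [Set.indicator_of_notMem h]
    positivity

lemma convR_integrable {g k : ℝ → ℝ} (hg : Integrable g) (hk : Integrable k) :
    Integrable (convR g k) :=
  hg.integrable_convolution (ContinuousLinearMap.mul ℝ ℝ) hk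

lemma convR_integral {g k : ℝ → ℝ} (hg : Integrable g) (hk : Integrable k) :
    ∫ u, convR g k u = (∫ u, g u) * ∫ u, k u :=
  integral_convolution (ContinuousLinearMap.mul ℝ ℝ) hg hk

lemma convR_nonneg {g k : ℝ → ℝ} (hg : ∀ u, 0 ≤ g u) (hk : ∀ u, 0 ≤ k u) (u : ℝ) :
    0 ≤ convR g k u :=
  integral_nonneg fun v => mul_nonneg (hg v) (hk _)

lemma kappD_le_abs {ε : ℝ} (hε : 0 < ε) (v : ℝ) (s : Set ℝ) :
    ‖s.indicator (kappD (ε ^ 2)) v‖ ≤ 1 / (2 * π) / ε ^ 2 := by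
  refine (norm_indicator_le_norm_self _ _).trans ?_
  rw [Real.norm_of_nonneg (kappD_nonneg (by positivity) v)]
  exact kappD_le (by positivity) v

lemma conv_ind_integrable {ε : ℝ} (hε : 0 < ε) {g : ℝ → ℝ} (hg : Integrable g) (u : ℝ)
    {s : Set ℝ} (hs : MeasurableSet s) :
    Integrable fun v => g v * s.indicator (kappD (ε ^ 2)) (u - v) := by
  refine hg.mul_bdd (c := 1 / (2 * π) / ε ^ 2) ?_ ?_
  · exact (((kappD_meas _).indicator hs).comp (measurable_const.sub measurable_id)).aestronglyMeasurable
  · exact Filter.Eventually.of_forall fun v => kappD_le_abs hε _ _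

lemma convR_split {ε : ℝ} (hε : 0 < ε) {g : ℝ → ℝ} (hg : Integrable g) (u : ℝ) :
    convR g (kappD (ε ^ 2)) u = convR g (kMid ε) u + convR g (kTail ε) u := by
  unfold convR
  rw [← integral_add]
  · simp_rw [← mul_add, kMid_add_kTail]
  · exact conv_ind_integrable hε hg u (tailSet_meas ε).compl
  · exact conv_ind_integrable hε hg u (tailSet_meas ε)

lemma integral_const_kMid {ε : ℝ} (a u : ℝ) :
    ∫ v, a * kMid ε (u - v) = a * ∫ v, kMid ε v := by
  rw [integral_const_mul, integral_sub_left_eq_self]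

lemma convMid_le {ε : ℝ} (hε : 0 < ε) {g : ℝ → ℝ} (hg : Integrable g) (u a : ℝ)
    (h : ∀ v, |u - v| ≤ ε → g v ≤ a) :
    convR g (kMid ε) u ≤ a * ∫ v, kMid ε v := by
  rw [← integral_const_kMid a u]
  refine integral_mono (conv_ind_integrable hε hg u (tailSet_meas ε).compl)
    (((kMid_integrable hε).comp_sub_left u).const_mul a) fun v => ?_
  dsimp only
  by_cases hv : |u - v| ≤ ε
  · exact mul_le_mul_of_nonneg_right (h v hv) (kMid_nonneg hε _)
  · have : kMid ε (u - v) = 0 := by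
      unfold kMid
      rw [Set.indicator_of_notMem]
      simpa using hv
    change _ * kMid ε (u - v) ≤ _ * kMid ε (u - v)
    rw [this]; simp

lemma le_convMid {ε : ℝ} (hε : 0 < ε) {g : ℝ → ℝ} (hg : Integrable g) (u a : ℝ)
    (h : ∀ v, |u - v| ≤ ε → a ≤ g v) :
    a * ∫ v, kMid ε v ≤ convR g (kMid ε) u := by
  rw [← integral_const_kMid a u]
  refine integral_mono (((kMid_integrable hε).comp_sub_left u).const_mul a)
    (conv_ind_integrable hε hg u (tailSet_meas ε).compl) fun v => ?_
  dsimp only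
  by_cases hv : |u - v| ≤ ε
  · exact mul_le_mul_of_nonneg_right (h v hv) (kMid_nonneg hε _)
  · have : kMid ε (u - v) = 0 := by
      unfold kMid
      rw [Set.indicator_of_notMem]
      simpa using hv
    change _ * kMid ε (u - v) ≤ _ * kMid ε (u - v)
    rw [this]; simp



lemma upReg_mono {h : ℝ → ℝ} (hb : ∀ K : Set ℝ, IsCompact K → BddAbove (h '' K)) {a b u v : ℝ} (ha : 0 ≤ a) (hab : a + |u - v| ≤ b) :
    upReg h a v ≤ upReg h b u := by
  have := abs_le.mp (le_refl |u - v|)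
  refine csSup_le_csSup (hb _ isCompact_Icc) ?_ ?_
  · exact (Set.nonempty_Icc.mpr (by linarith)).image h
  · exact Set.image_mono (Set.Icc_subset_Icc (by linarith) (by linarith))


lemma le_upReg {h : ℝ → ℝ} (hb : ∀ K : Set ℝ, IsCompact K → BddAbove (h '' K)) {a u : ℝ} (ha : 0 ≤ a) : h u ≤ upReg h a u :=
  le_csSup (hb _ isCompact_Icc) ⟨u, ⟨by linarith, by linarith⟩, rfl⟩


lemma bddBelow_img {h : ℝ → ℝ} (h0 : ∀ u, 0 ≤ h u) (s : Set ℝ) : BddBelow (h '' s) :=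
  ⟨0, by rintro _ ⟨x, -, rfl⟩; exact h0 x⟩


lemma loReg_mono {h : ℝ → ℝ} (h0 : ∀ u, 0 ≤ h u) {a b u v : ℝ} (ha : 0 ≤ a) (hab : a + |u - v| ≤ b) :
    loReg h b u ≤ loReg h a v := by
  have := abs_le.mp (le_refl |u - v|)
  refine csInf_le_csInf (bddBelow_img h0 _) ?_ ?_
  · exact (Set.nonempty_Icc.mpr (by linarith)).image h
  · exact Set.image_mono (Set.Icc_subset_Icc (by linarith) (by linarith))


lemma loReg_le {h : ℝ → ℝ} (h0 : ∀ u, 0 ≤ h u) {a u : ℝ} (ha : 0 ≤ a) : loReg h a u ≤ h u :=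
  csInf_le (bddBelow_img h0 _) ⟨u, ⟨by linarith, by linarith⟩, rfl⟩


lemma loReg_nonneg {h : ℝ → ℝ} (h0 : ∀ u, 0 ≤ h u) {a u : ℝ} : 0 ≤ loReg h a u :=
  Real.sInf_nonneg (by rintro _ ⟨x, -, rfl⟩; exact h0 x)

lemma weighted_le {W : ℝ → ℝ} {M : ℝ} (hW1 : ∀ v, W v ≤ M)
    {f : ℝ → ℝ} (hf0 : ∀ u, 0 ≤ f u) (hf : Integrable f) (hfW : Integrable fun v => f v * W v) :
    ∫ v, f v * W v ≤ M * ∫ v, f v := by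
  rw [← integral_const_mul]
  refine integral_mono hfW (hf.const_mul M) fun v => ?_
  have := mul_le_mul_of_nonneg_left (hW1 v) (hf0 v)
  dsimp only; linarith

/-- The three bounds with an abstract bounded weight. -/
lemma core {W : ℝ → ℝ} {M : ℝ} (hW0 : ∀ v, 0 ≤ W v) (hW1 : ∀ v, W v ≤ M) (hWm : Measurable W)
    {ε : ℝ} (hε : 0 < ε) {h : ℝ → ℝ} (hh : MemH ε h)
    (hu : Integrable (upReg h (2 * ε))) (hl : Integrable (loReg h (2 * ε))) :
    (∫ v, convR (upReg h ε) (kappD (ε ^ 2)) v * W v ≤ (∫ v, h v * W v) +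
      4 * M * (∫ u, |upReg h (2 * ε) u - h u|) + 4 * M * ε * ∫ u, |h u|) ∧
    (∫ v, convR (upReg h ε) (kappD (ε ^ 2)) v * W v ≤ 4 * M * ∫ u, |upReg h ε u|) ∧
    ((∫ v, h v * W v) - 4 * M * (∫ u, |h u - loReg h (2 * ε) u|) - 4 * M * ε * (∫ u, |h u|) ≤
      ∫ v, convR (loReg h ε) (kappD (ε ^ 2)) v * W v) := by
  obtain ⟨h0, hb, -, -, -, hi, hui, hli⟩ := hh
  have hε2 : 0 < ε ^ 2 := by positivity
  have hM : 0 ≤ M := (hW0 0).trans (hW1 0)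
  have bW : ∀ {f : ℝ → ℝ}, Integrable f → Integrable fun v => f v * W v := by
    intro f hf
    refine hf.mul_bdd (c := M) hWm.aestronglyMeasurable (Filter.Eventually.of_forall fun v => ?_)
    rw [Real.norm_of_nonneg (hW0 v)]; exact hW1 v
  have mW : ∀ {f g : ℝ → ℝ}, Integrable f → Integrable g → (∀ u, f u ≤ g u) →
      ∫ v, f v * W v ≤ ∫ v, g v * W v := by
    intro f g hf hg hfg
    exact integral_mono (bW hf) (bW hg) fun v => mul_le_mul_of_nonneg_right (hfg v) (hW0 v)
  have u0 : ∀ a, 0 ≤ a → ∀ u, 0 ≤ upReg h a u := fun a ha u => (h0 u).trans (le_upReg hb ha)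
  have hm0 := kTail_integral_nonneg hε
  have hm1 := kTail_integral_le_one hε
  have hm2 := kTail_integral_le hε
  have hmid := kMid_integral hε
  have aabs : ∫ u, |h u| = ∫ u, h u := integral_congr_ae (Filter.Eventually.of_forall fun u => abs_of_nonneg (h0 u))
  have uabs : ∫ u, |upReg h ε u| = ∫ u, upReg h ε u :=
    integral_congr_ae (Filter.Eventually.of_forall fun u => abs_of_nonneg (u0 ε hε.le u))
  have dabs : ∫ u, |upReg h (2 * ε) u - h u| = ∫ u, (upReg h (2 * ε) u - h u) :=
    integral_congr_ae (Filter.Eventually.of_forall fun u =>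
      abs_of_nonneg (sub_nonneg.mpr (le_upReg hb (by linarith))))
  have eabs : ∫ u, |h u - loReg h (2 * ε) u| = ∫ u, (h u - loReg h (2 * ε) u) :=
    integral_congr_ae (Filter.Eventually.of_forall fun u =>
      abs_of_nonneg (sub_nonneg.mpr (loReg_le h0 (by linarith))))
  rw [aabs, uabs, dabs, eabs]
  have hH0 : 0 ≤ ∫ u, h u := integral_nonneg h0
  have hGu := convR_integrable hui (kappD_integrable hε2)
  have hGl := convR_integrable hli (kappD_integrable hε2)
  have hTu := convR_integrable hui (kTail_integrable hε)
  refine ⟨?_, ?_, ?_⟩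
  · set D := ∫ u, (upReg h (2 * ε) u - h u) with hD
    have hD0 : 0 ≤ D := integral_nonneg fun u => sub_nonneg.mpr (le_upReg hb (by linarith))
    have s1 : ∫ v, convR (upReg h ε) (kappD (ε ^ 2)) v * W v ≤
        ∫ v, (h v + (upReg h (2 * ε) v - h v) + convR (upReg h ε) (kTail ε) v) * W v := by
      refine mW hGu ((hi.add (hu.sub hi)).add hTu) fun u => ?_
      rw [convR_split hε hui]
      have := convMid_le hε hui u (upReg h (2 * ε) u) fun v hv =>
        upReg_mono hb hε.le (by linarith)
      rw [hmid] at this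
      have := mul_nonneg (u0 (2 * ε) (by linarith) u) hm0
      linarith
    have s2 : ∫ v, (h v + (upReg h (2 * ε) v - h v) + convR (upReg h ε) (kTail ε) v) * W v =
        (∫ v, h v * W v) + (∫ v, (upReg h (2 * ε) v - h v) * W v) +
          ∫ v, convR (upReg h ε) (kTail ε) v * W v := by
      have b1 := bW hi
      have b2 := bW (hu.sub hi)
      have b3 := bW hTu
      simp only [Pi.sub_apply] at b2
      have b12 : Integrable fun v => h v * W v + (upReg h (2 * ε) v - h v) * W v := b1.add b2
      rw [← integral_add b1 b2, ← integral_add b12 b3]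
      simp_rw [add_mul]
    have s3 : ∫ v, (upReg h (2 * ε) v - h v) * W v ≤ M * D :=
      weighted_le hW1 (fun u => sub_nonneg.mpr (le_upReg hb (by linarith))) (hu.sub hi) (bW (hu.sub hi))
    have s4 : ∫ v, convR (upReg h ε) (kTail ε) v * W v ≤ M * ((∫ u, upReg h ε u) * ∫ v, kTail ε v) := by
      rw [← convR_integral hui (kTail_integrable hε)]
      exact weighted_le hW1 (convR_nonneg (u0 ε hε.le) (kTail_nonneg hε)) hTu (bW hTu)
    have s5 : ∫ u, upReg h ε u ≤ (∫ u, h u) + D := by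
      rw [hD, integral_sub hu hi]
      have : ∫ u, upReg h ε u ≤ ∫ u, upReg h (2 * ε) u :=
        integral_mono hui hu fun u => upReg_mono hb hε.le (by simp; linarith)
      linarith
    have s6 : (∫ u, upReg h ε u) * ∫ v, kTail ε v ≤ 4 * ε * (∫ u, h u) + D := by
      have := mul_le_mul_of_nonneg_right s5 hm0
      nlinarith
    have s7 := mul_le_mul_of_nonneg_left s6 hM
    have : 0 ≤ M * D := by positivity
    rw [s2] at s1
    linarith
  · refine (weighted_le hW1 (convR_nonneg (u0 ε hε.le) (kappD_nonneg hε2)) hGu (bW hGu)).trans ?_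
    rw [convR_integral hui (kappD_integrable hε2), kappD_integral hε2, mul_one]
    have : 0 ≤ M * ∫ u, upReg h ε u := mul_nonneg hM (integral_nonneg (u0 ε hε.le))
    linarith
  · set D := ∫ u, (h u - loReg h (2 * ε) u) with hD
    have hD0 : 0 ≤ D := integral_nonneg fun u => sub_nonneg.mpr (loReg_le h0 (by linarith))
    set m := ∫ v, kTail ε v with hm
    have s1 : (∫ v, (loReg h (2 * ε) v - m * loReg h (2 * ε) v) * W v) ≤
        ∫ v, convR (loReg h ε) (kappD (ε ^ 2)) v * W v := by
      refine mW (hl.sub (hl.const_mul m)) hGl fun u => ?_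
      rw [convR_split hε hli]
      have h1 := le_convMid hε hli u (loReg h (2 * ε) u) fun v hv =>
        loReg_mono h0 hε.le (by linarith)
      rw [hmid] at h1
      have h2 : 0 ≤ convR (loReg h ε) (kTail ε) u :=
        convR_nonneg (fun _ => loReg_nonneg h0) (kTail_nonneg hε) u
      linarith
    have b1 := bW hl
    have s2 : (∫ v, (loReg h (2 * ε) v - m * loReg h (2 * ε) v) * W v) =
        (1 - m) * ∫ v, loReg h (2 * ε) v * W v := by
      rw [← integral_const_mul]
      congr 1; ext v; ring
    have s3 : ∫ v, (h v - loReg h (2 * ε) v) * W v ≤ M * D :=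
      weighted_le hW1 (fun u => sub_nonneg.mpr (loReg_le h0 (by linarith))) (hi.sub hl) (bW (hi.sub hl))
    have s4 : ∫ v, (h v - loReg h (2 * ε) v) * W v =
        (∫ v, h v * W v) - ∫ v, loReg h (2 * ε) v * W v := by
      rw [← integral_sub (bW hi) b1]
      simp_rw [sub_mul]
    have s5 : ∫ v, loReg h (2 * ε) v * W v ≤ M * ∫ v, h v :=
      (mW hl hi fun u => loReg_le h0 (by linarith)).trans (weighted_le hW1 h0 hi (bW hi))
    have s6 : m * ∫ v, loReg h (2 * ε) v * W v ≤ 4 * ε * (M * ∫ v, h v) := by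
      have : 0 ≤ M * ∫ v, h v := by positivity
      exact (mul_le_mul_of_nonneg_left s5 hm0).trans (mul_le_mul_of_nonneg_right hm2 this)
    have : 0 ≤ M * D := by positivity
    rw [s2] at s1
    linarith

/-- Lemma 5.3: Gaussian bounds for the smoothed regularisations. -/
theorem smoothed_gaussian_bounds :
    ∀ σ : ℝ, 0 < σ → ∃ c > 0, ∀ ε : ℝ, 0 < ε → ∀ h : ℝ → ℝ, MemH ε h →
      Measurable (upReg h (2 * ε)) → Integrable (upReg h (2 * ε)) →
      Measurable (loReg h (2 * ε)) → Integrable (loReg h (2 * ε)) →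
      ∀ y : ℝ, ∀ n : ℕ, 1 ≤ n →
        (Real.sqrt n *
              convR (convR (upReg h ε) (kappD (ε ^ 2))) (gauss (σ * Real.sqrt n)) y ≤
            Real.sqrt n * convR h (gauss (σ * Real.sqrt n)) y +
              c * (∫ u : ℝ, |upReg h (2 * ε) u - h u|) + c * ε * ∫ u : ℝ, |h u|) ∧
        (Real.sqrt n *
              convR (convR (upReg h ε) (kappD (ε ^ 2))) (gauss (σ * Real.sqrt n)) y ≤
            c * ∫ u : ℝ, |upReg h ε u|) ∧
        (Real.sqrt n * convR h (gauss (σ * Real.sqrt n)) y -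
              c * (∫ u : ℝ, |h u - loReg h (2 * ε) u|) - c * ε * (∫ u : ℝ, |h u|) ≤
            Real.sqrt n *
              convR (convR (loReg h ε) (kappD (ε ^ 2))) (gauss (σ * Real.sqrt n)) y) := by
  intro σ hσ
  refine ⟨4 * (1 / (σ * Real.sqrt (2 * π))), by positivity, ?_⟩
  intro ε hε h hh _ hu _ hl y n hn
  have hn' : (0 : ℝ) < Real.sqrt n := Real.sqrt_pos.mpr (by exact_mod_cast hn)
  have key := core (W := fun v => Real.sqrt n * gauss (σ * Real.sqrt n) (y - v))
    (M := 1 / (σ * Real.sqrt (2 * π))) ?_ ?_ ?_ hε hh hu hl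
  · have e : ∀ f : ℝ → ℝ, Real.sqrt n * convR f (gauss (σ * Real.sqrt n)) y =
        ∫ v, f v * (Real.sqrt n * gauss (σ * Real.sqrt n) (y - v)) := by
      intro f
      unfold convR
      rw [← integral_const_mul]
      congr 1; ext v; ring
    simp only [e]
    exact key
  · intro v
    unfold gauss
    positivity
  · intro v
    unfold gauss
    have h1 : Real.exp (-(y - v) ^ 2 / (2 * (σ * Real.sqrt n) ^ 2)) ≤ 1 := by
      rw [Real.exp_le_one_iff]
      exact div_nonpos_of_nonpos_of_nonneg (by nlinarith [sq_nonneg (y - v)]) (by positivity)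
    calc _ = Real.exp (-(y - v) ^ 2 / (2 * (σ * Real.sqrt n) ^ 2)) / (σ * Real.sqrt (2 * π)) := by
          field_simp
      _ ≤ _ := by gcongr
  · unfold gauss
    fun_prop

end CLLT
end
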